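/- Let (f,ξ) be a classical solution of the Vlasov–Poisson system with point charge on [0,T] and let k ≥ 0. Then for all t ∈ [0,T]: (d/dt) H̃_k(t) ≤ C(k) ( ‖E(t)‖_{L^{k+3}(ℝ³)} + |E(t,ξ(t))| ) H_k(t)^{(k+2)/(k+3)}, and consequently H_k(t) ≤ C(k) { H_k(0) + ( ∫₀ᵗ [ ‖E(s)‖_{L^{k+3}(ℝ³)} + |E(s,ξ(s))| ] ds )^{k+3} }, where C(k) depends only on k, M₀, ‖f₀‖_{L∞} and 𝓗(0). -/

import Mathlib

open MeasureTheory Set Filter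
open scoped ENNReal

noncomputable section

/-- Three-dimensional Euclidean space. -/
abbrev E3 : Type := EuclideanSpace ℝ (Fin 3)

/-- Spatial density `ρ(t,x) = ∫ f(t,x,v) dv`. -/
def rho (f : ℝ → E3 → E3 → ℝ) (t : ℝ) (x : E3) : ℝ := ∫ v : E3, f t x v

/-- Self-induced electric field `E(t,x) = ∫ (x-y)/|x-y|³ ρ(t,y) dy`. -/
def Efield (f : ℝ → E3 → E3 → ℝ) (t : ℝ) (x : E3) : E3 :=
  ∫ y : E3, (rho f t y / ‖x - y‖ ^ 3) • (x - y)

/-- Singular field generated by the point charge located at `ξ t`: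
`F(t,x) = (x-ξ(t))/|x-ξ(t)|³`. -/
def Fpt (ξ : ℝ → E3) (t : ℝ) (x : E3) : E3 := (‖x - ξ t‖ ^ 3)⁻¹ • (x - ξ t)

/-- Total mass `M(t) = ∬ f(t,x,v) dx dv`. -/
def mass (f : ℝ → E3 → E3 → ℝ) (t : ℝ) : ℝ := ∫ p : E3 × E3, f t p.1 p.2

/-- Total energy `𝓗(t)`. -/
def energy (f : ℝ → E3 → E3 → ℝ) (ξ η : ℝ → E3) (t : ℝ) : ℝ :=
    (1 / 2) * ∫ p : E3 × E3, ‖p.2‖ ^ 2 * f t p.1 p.2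
  + (1 / 2) * ‖η t‖ ^ 2
  + (1 / 2) * ∫ x : E3, ∫ y : E3, rho f t x * rho f t y / ‖x - y‖
  + ∫ x : E3, rho f t x / ‖x - ξ t‖

/-- `L^∞` norm of the initial datum `‖f₀‖_{L^∞}`. -/
def supf0 (f : ℝ → E3 → E3 → ℝ) : ℝ :=
  (eLpNorm (fun p : E3 × E3 => f 0 p.1 p.2) ⊤ volume).toReal

/-- A classical solution of the Vlasov–Poisson system with point charge on `[0,T]`:
`f` is a nonnegative `C¹` compactly supported density whose initial datum vanishes
in a neighborhood of the charge `ξ 0`, `ξ ∈ C²` with `ξ' = η`, `η' = E(t,ξ(t))`,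
and the Vlasov equation holds pointwise (away from the charge). -/
structure VPClassicalSolution (T : ℝ) where
  f : ℝ → E3 → E3 → ℝ
  ξ : ℝ → E3
  η : ℝ → E3
  T_pos : 0 < T
  f_nonneg : ∀ t x v, 0 ≤ f t x v
  f_c1 : ContDiff ℝ 1 (fun p : ℝ × E3 × E3 => f p.1 p.2.1 p.2.2)
  f_cpt : HasCompactSupport (fun p : ℝ × E3 × E3 => f p.1 p.2.1 p.2.2)
  f0_vanishes_near_charge : ∃ ε > 0, ∀ x v, ‖x - ξ 0‖ < ε → f 0 x v = 0
  ξ_c2 : ContDiff ℝ 2 ξ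
  ξ_ode : ∀ t, HasDerivAt ξ (η t) t
  η_ode : ∀ t ∈ Icc (0 : ℝ) T, HasDerivAt η (Efield f t (ξ t)) t
  vlasov : ∀ t ∈ Icc (0 : ℝ) T, ∀ x v, x ≠ ξ t →
      deriv (fun τ : ℝ => f τ x v) t
      + fderiv ℝ (fun y : E3 => f t y v) x v
      + fderiv ℝ (fun w : E3 => f t x w) v (Efield f t x + Fpt ξ t x) = 0

/-- The microscopic energy function
`h(t,x,v) = |v-η(t)|²/2 + 1/|x-ξ(t)| + 𝓗(0) + M₀⁻¹ + 1`. -/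
def hEnergy (f : ℝ → E3 → E3 → ℝ) (ξ η : ℝ → E3) (t : ℝ) (x v : E3) : ℝ :=
  ‖v - η t‖ ^ 2 / 2 + ‖x - ξ t‖⁻¹ + energy f ξ η 0 + (mass f 0)⁻¹ + 1

/-- The energy moment `H̃_k(t) = ∬ h(t,x,v)^{k/2} f(t,x,v) dx dv`. -/
def Htilde (f : ℝ → E3 → E3 → ℝ) (ξ η : ℝ → E3) (k t : ℝ) : ℝ :=
  ∫ p : E3 × E3, hEnergy f ξ η t p.1 p.2 ^ (k / 2) * f t p.1 p.2

/-- The running supremum of the energy moments `H_k(t) = sup_{0≤s≤t} H̃_k(s)`. -/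
def Hmom (f : ℝ → E3 → E3 → ℝ) (ξ η : ℝ → E3) (k t : ℝ) : ℝ :=
  sSup (Htilde f ξ η k '' Icc 0 t)

theorem integrableOn_ball_inv_norm_pow {n : ℕ} (hn : n ≤ 2) (r : ℝ) :
    IntegrableOn (fun x : E3 => (‖x‖ ^ n)⁻¹) (Metric.ball 0 r) := by
  rw [integrableOn_fun_norm_addHaar volume (f := fun y : ℝ => (y ^ n)⁻¹)]
  have h : IntegrableOn (fun y : ℝ => y ^ (2 - n)) (Ioo 0 r) :=
    (((continuous_pow (2 - n)).continuousOn).integrableOn_Icc (a := 0) (b := r)).mono_set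
      Ioo_subset_Icc_self
  refine h.congr_fun (fun y hy => ?_) measurableSet_Ioo
  have hy0 : y ≠ 0 := hy.1.ne'
  simp only [finrank_euclideanSpace, Fintype.card_fin, smul_eq_mul]
  rw [eq_mul_inv_iff_mul_eq₀ (pow_ne_zero _ hy0), ← pow_add]
  congr 1
  omega

/-- The integral of `‖w‖⁻¹` over the unit ball. -/
def ballInvNormIntegral : ℝ := ∫ w in Metric.ball (0 : E3) 1, ‖w‖⁻¹

theorem ballInvNormIntegral_nonneg : 0 ≤ ballInvNormIntegral :=
  integral_nonneg fun _ => by positivity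

theorem integrableOn_ball_inv_norm_sub_pow {n : ℕ} (hn : n ≤ 2) (a : E3) (r : ℝ) :
    IntegrableOn (fun x : E3 => (‖x - a‖ ^ n)⁻¹) (Metric.ball a r) := by
  have h := integrableOn_ball_inv_norm_pow hn r
  have hm := (measurePreserving_sub_right (volume : Measure E3) a)
  have := (hm.integrableOn_comp_preimage (MeasurableEquiv.subRight a).measurableEmbedding
    (f := fun x : E3 => (‖x‖ ^ n)⁻¹) (s := Metric.ball 0 r)).2 h
  have hs : Metric.ball a r = (fun x => x - a) ⁻¹' Metric.ball 0 r := by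
    ext x
    simp [dist_eq_norm]
  rw [hs]
  exact this

theorem setIntegral_ball_comp_norm_sub (g : ℝ → ℝ) (a : E3) (r : ℝ) :
    ∫ v in Metric.ball a r, g ‖v - a‖ = ∫ v in Metric.ball (0 : E3) r, g ‖v‖ := by
  have := (measurePreserving_sub_right (volume : Measure E3) a).setIntegral_preimage_emb
    (MeasurableEquiv.subRight a).measurableEmbedding (fun v => g ‖v‖) (Metric.ball 0 r)
  rw [← this]
  congr 2
  ext x
  simp [dist_eq_norm]

theorem setIntegral_ball_inv_norm_sub (a : E3) {r : ℝ} (hr : 0 < r) :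
    ∫ v in Metric.ball a r, ‖v - a‖⁻¹ = ballInvNormIntegral * r ^ 2 := by
  have h2 := Measure.setIntegral_comp_smul_of_pos (volume : Measure E3) (fun v : E3 => ‖v‖⁻¹)
    (Metric.ball 0 1) hr
  rw [smul_unitBall hr.ne'] at h2
  simp only [norm_smul, mul_inv, Real.norm_eq_abs, abs_of_pos hr, finrank_euclideanSpace,
    Fintype.card_fin, smul_eq_mul, integral_const_mul] at h2
  rw [setIntegral_ball_comp_norm_sub (fun s => s⁻¹), ballInvNormIntegral]
  field_simp at h2 ⊢
  linarith

theorem integral_fderiv_apply_eq_zero {H : E3 → ℝ} (hH : ContDiff ℝ 1 H)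
    (hc : HasCompactSupport H) (w : E3) : ∫ x, fderiv ℝ H x w = 0 := by
  have h := integral_mul_fderiv_eq_neg_fderiv_mul_of_integrable (μ := (volume : Measure E3))
    (f := fun _ : E3 => (1 : ℝ)) (g := H) (v := w) (by simp)
    (by
      simp only [one_mul]
      exact ((hH.continuous_fderiv one_ne_zero).clm_apply continuous_const).integrable_of_hasCompactSupport
        (hc.fderiv_apply ℝ w))
    (by simpa using hH.continuous.integrable_of_hasCompactSupport hc)
    (fun x _ => by fun_prop) (fun x _ => (hH.differentiable one_ne_zero) x)
  simpa using h

theorem hasDerivAt_integral_transport {G : ℝ × E3 × E3 → ℝ} (hG : ContDiff ℝ 1 G)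
    (hc : HasCompactSupport G) {a : E3 → E3} (ha : AEStronglyMeasurable a)
    (hloc : ∀ r, IntegrableOn a (Metric.closedBall 0 r)) (t : ℝ) :
    Integrable (fun p : E3 × E3 => fderiv ℝ G (t, p) (1, p.2, a p.1)) ∧
    HasDerivAt (fun τ => ∫ p : E3 × E3, G (τ, p))
      (∫ p : E3 × E3, fderiv ℝ G (t, p) (1, p.2, a p.1)) t := by
  have hdc : Continuous (fderiv ℝ G) := hG.continuous_fderiv one_ne_zero
  have hdiff : Differentiable ℝ G := hG.differentiable one_ne_zero
  obtain ⟨C, hC⟩ := (hc.fderiv ℝ).exists_bound_of_continuous hdc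
  obtain ⟨r, hr⟩ := hc.isCompact.isBounded.subset_closedBall 0
  have hz : ∀ q : ℝ × E3 × E3, r < ‖q‖ → fderiv ℝ G q = 0 := fun q hq => by
    by_contra h
    have := hr (support_fderiv_subset ℝ h)
    rw [mem_closedBall_zero_iff] at this
    linarith
  have hC0 : 0 ≤ C := (norm_nonneg _).trans (hC 0)
  have hcs : ∀ τ : ℝ, HasCompactSupport fun p : E3 × E3 => G (τ, p) := fun τ => by
    refine HasCompactSupport.intro (isCompact_closedBall (0 : E3 × E3) r) fun p hp => ?_
    by_contra h
    have := hr (subset_tsupport _ h)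
    rw [mem_closedBall_zero_iff] at this hp
    exact hp ((le_max_right _ _).trans this)
  -- the time derivative
  have h1 : Integrable (fun p : E3 × E3 => fderiv ℝ G (t, p) (1, 0, 0)) ∧
      HasDerivAt (fun τ => ∫ p : E3 × E3, G (τ, p))
      (∫ p : E3 × E3, fderiv ℝ G (t, p) (1, 0, 0)) t := by
    refine hasDerivAt_integral_of_dominated_loc_of_deriv_le
      (F' := fun τ (p : E3 × E3) => fderiv ℝ G (τ, p) (1, 0, 0)) (s := univ)
      (bound := (Metric.closedBall (0 : E3 × E3) r).indicator fun _ => C) univ_mem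
      (Eventually.of_forall fun τ => ?_) ?_ ?_ (Eventually.of_forall fun p τ _ => ?_) ?_
      (Eventually.of_forall fun p τ _ => ?_)
    · exact (hG.continuous.comp (by fun_prop)).aestronglyMeasurable
    · exact (hG.continuous.comp (by fun_prop)).integrable_of_hasCompactSupport (hcs t)
    · exact ((hdc.comp (by fun_prop : Continuous fun p : E3 × E3 => (t, p))).clm_apply
        continuous_const).aestronglyMeasurable
    · by_cases hp : ‖p‖ ≤ r
      · rw [indicator_of_mem (by simpa using hp)]
        refine ((fderiv ℝ G (τ, p)).le_opNorm _).trans ?_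
        have : ‖((1 : ℝ), (0 : E3), (0 : E3))‖ = 1 := by simp [Prod.norm_def]
        rw [this, mul_one]
        exact hC _
      · rw [hz (τ, p) ((not_le.1 hp).trans_le (le_max_right _ _))]
        simpa using indicator_nonneg (fun _ _ => hC0) p
    · exact (integrable_indicator_iff Metric.isClosed_closedBall.measurableSet).2
        (integrableOn_const (isCompact_closedBall _ _).measure_ne_top)
    · have h := (hdiff (τ, p)).hasFDerivAt.comp_hasDerivAt τ
        ((hasDerivAt_id τ).prodMk (hasDerivAt_const τ p))
      exact h
  -- the transport in position
  have h2 : Integrable (fun p : E3 × E3 => fderiv ℝ G (t, p) (0, p.2, 0)) ∧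
      ∫ p : E3 × E3, fderiv ℝ G (t, p) (0, p.2, 0) = 0 := by
    have hi : Integrable (fun p : E3 × E3 => fderiv ℝ G (t, p) (0, p.2, 0)) := by
      refine Continuous.integrable_of_hasCompactSupport
        ((hdc.comp (by fun_prop : Continuous fun p : E3 × E3 => (t, p))).clm_apply
        (by fun_prop)) ?_
      refine HasCompactSupport.intro (isCompact_closedBall (0 : E3 × E3) r) fun p hp => ?_
      rw [mem_closedBall_zero_iff, not_le] at hp
      rw [hz (t, p) (hp.trans_le (le_max_right _ _))]
      simp
    refine ⟨hi, ?_⟩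
    rw [Measure.volume_eq_prod] at hi ⊢
    rw [integral_prod_symm _ hi]
    refine integral_eq_zero_of_ae (Eventually.of_forall fun v => ?_)
    have hc1 : ContDiff ℝ 1 fun x : E3 => G (t, x, v) := hG.comp (by fun_prop)
    have hc2 : HasCompactSupport fun x : E3 => G (t, x, v) := by
      refine HasCompactSupport.intro (isCompact_closedBall (0 : E3) r) fun x hp => ?_
      by_contra h
      have := hr (subset_tsupport _ h)
      rw [mem_closedBall_zero_iff] at this hp
      exact hp (((le_max_left _ _).trans (le_max_right _ _)).trans this)
    refine Eq.trans ?_ (integral_fderiv_apply_eq_zero hc1 hc2 v)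
    refine integral_congr_ae (Eventually.of_forall fun x => ?_)
    beta_reduce
    have h := (hdiff (t, x, v)).hasFDerivAt.comp (f := fun y : E3 => (t, y, v)) x
      ((hasFDerivAt_const t x).prodMk ((hasFDerivAt_id x).prodMk (hasFDerivAt_const v x)))
    have h' := h.fderiv
    simp only [Function.comp_def] at h'
    rw [h']
    simp
  -- the transport in velocity
  have h3 : Integrable (fun p : E3 × E3 => fderiv ℝ G (t, p) (0, 0, a p.1)) ∧
      ∫ p : E3 × E3, fderiv ℝ G (t, p) (0, 0, a p.1) = 0 := by
    have hi : Integrable (fun p : E3 × E3 => fderiv ℝ G (t, p) (0, 0, a p.1)) := by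
      have hb : Integrable (fun p : E3 × E3 =>
          ((Metric.closedBall (0 : E3) r).indicator (fun x => ‖a x‖) p.1) *
          ((Metric.closedBall (0 : E3) r).indicator (fun _ => C) p.2))
          (volume.prod volume) :=
        Integrable.mul_prod
          ((integrable_indicator_iff Metric.isClosed_closedBall.measurableSet).2 (hloc r).norm)
          ((integrable_indicator_iff Metric.isClosed_closedBall.measurableSet).2
            (integrableOn_const (isCompact_closedBall _ _).measure_ne_top))
      refine hb.mono' ?_ (Eventually.of_forall fun p => ?_)
      · have hm : AEStronglyMeasurable (fun p : E3 × E3 => ((0 : ℝ), (0 : E3), a p.1))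
            (volume.prod volume) :=
          aestronglyMeasurable_const.prodMk (aestronglyMeasurable_const.prodMk ha.comp_fst)
        exact (ContinuousLinearMap.apply ℝ ℝ).flip.aestronglyMeasurable_comp₂
          (hdc.comp (by fun_prop : Continuous fun p : E3 × E3 => (t, p))).aestronglyMeasurable hm
      · by_cases hp : r < ‖(t, p)‖
        · rw [hz _ hp]
          simp only [_root_.zero_apply, norm_zero]
          exact mul_nonneg (indicator_nonneg (fun _ _ => norm_nonneg _) _)
            (indicator_nonneg (fun _ _ => hC0) _)
        · have hp' : ‖p‖ ≤ r := (le_max_right _ _).trans (not_lt.1 hp)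
          rw [indicator_of_mem (by simpa using (norm_fst_le p).trans hp'),
            indicator_of_mem (by simpa using (norm_snd_le p).trans hp'), mul_comm]
          refine ((fderiv ℝ G (t, p)).le_opNorm _).trans ?_
          have : ‖((0 : ℝ), (0 : E3), a p.1)‖ = ‖a p.1‖ := by simp [Prod.norm_def]
          rw [this]
          exact mul_le_mul_of_nonneg_right (hC _) (norm_nonneg _)
    refine ⟨hi, ?_⟩
    rw [Measure.volume_eq_prod] at hi ⊢
    rw [integral_prod _ hi]
    refine integral_eq_zero_of_ae (Eventually.of_forall fun x => ?_)
    have hc1 : ContDiff ℝ 1 fun v : E3 => G (t, x, v) := hG.comp (by fun_prop)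
    have hc2 : HasCompactSupport fun v : E3 => G (t, x, v) := by
      refine HasCompactSupport.intro (isCompact_closedBall (0 : E3) r) fun v hp => ?_
      by_contra h
      have := hr (subset_tsupport _ h)
      rw [mem_closedBall_zero_iff] at this hp
      exact hp (((le_max_right _ _).trans (le_max_right _ _)).trans this)
    refine Eq.trans ?_ (integral_fderiv_apply_eq_zero hc1 hc2 (a x))
    refine integral_congr_ae (Eventually.of_forall fun v => ?_)
    beta_reduce
    have h := (hdiff (t, x, v)).hasFDerivAt.comp (f := fun w : E3 => (t, x, w)) v
      ((hasFDerivAt_const t v).prodMk ((hasFDerivAt_const x v).prodMk (hasFDerivAt_id v)))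
    have h' := h.fderiv
    simp only [Function.comp_def] at h'
    rw [h']
    simp
  have hsum : (fun p : E3 × E3 => fderiv ℝ G (t, p) (1, p.2, a p.1)) =
      fun p : E3 × E3 => fderiv ℝ G (t, p) (1, 0, 0) + fderiv ℝ G (t, p) (0, p.2, 0)
        + fderiv ℝ G (t, p) (0, 0, a p.1) := by
    ext p
    rw [← map_add, ← map_add]
    simp
  rw [hsum]
  refine ⟨(h1.1.add h2.1).add h3.1, ?_⟩
  rw [integral_add (by exact h1.1.add h2.1) h3.1, integral_add h1.1 h2.1, h2.2, h3.2, add_zero, add_zero]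
  exact h1.2

namespace VPClassicalSolution

variable {T : ℝ} (S : VPClassicalSolution T)

theorem exists_bound_support : ∃ M r : ℝ, 0 ≤ M ∧ 0 < r ∧ (∀ t x v, S.f t x v ≤ M) ∧
    ∀ t x v, S.f t x v ≠ 0 → |t| ≤ r ∧ ‖x‖ ≤ r ∧ ‖v‖ ≤ r := by
  obtain ⟨M, hM⟩ := S.f_cpt.exists_bound_of_continuous S.f_c1.continuous
  obtain ⟨r, hr⟩ := S.f_cpt.isCompact.isBounded.subset_closedBall 0
  refine ⟨M, max r 1, (norm_nonneg _).trans (hM 0), by positivity,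
    fun t x v => (le_abs_self _).trans (hM (t, x, v)), fun t x v h => ?_⟩
  have h1 := hr (subset_tsupport _ (show (t, x, v) ∈ Function.support _ from h))
  rw [mem_closedBall_zero_iff] at h1
  have h2 : ‖(t, x, v)‖ ≤ max r 1 := h1.trans (le_max_left _ _)
  exact ⟨(le_max_left _ _).trans h2, ((le_max_left _ _).trans (le_max_right _ _)).trans h2,
    ((le_max_right _ _).trans (le_max_right _ _)).trans h2⟩

theorem rho_nonneg (t : ℝ) (x : E3) : 0 ≤ rho S.f t x :=
  integral_nonneg fun _ => S.f_nonneg _ _ _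

theorem exists_rho_bound : ∃ R r : ℝ, 0 ≤ R ∧ 0 < r ∧
    ∀ t x, rho S.f t x ≤ R * (Metric.closedBall (0 : E3) r).indicator 1 x := by
  obtain ⟨M, r, hM0, hr, hM, hs⟩ := S.exists_bound_support
  refine ⟨∫ v, M * (Metric.closedBall (0 : E3) r).indicator 1 v, r,
    integral_nonneg fun v => mul_nonneg hM0 (indicator_nonneg (fun _ _ => zero_le_one) _),
    hr, fun t x => ?_⟩
  by_cases hx : ‖x‖ ≤ r
  · rw [indicator_of_mem (by simpa using hx), Pi.one_apply, mul_one]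
    refine integral_mono_of_nonneg (Eventually.of_forall fun _ => S.f_nonneg _ _ _) ?_
      (Eventually.of_forall fun v => ?_)
    · exact ((integrable_indicator_iff Metric.isClosed_closedBall.measurableSet).2
        (integrableOn_const (isCompact_closedBall _ _).measure_ne_top)).const_mul M
    · by_cases hv : S.f t x v = 0
      · simp only [hv]
        exact mul_nonneg hM0 (indicator_nonneg (fun _ _ => zero_le_one) _)
      · beta_reduce
        rw [indicator_of_mem (mem_closedBall_zero_iff.2 (hs t x v hv).2.2)]
        simpa using hM t x v
  · rw [indicator_of_notMem (by simpa using hx), mul_zero]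
    refine (integral_eq_zero_of_ae (Eventually.of_forall fun v => ?_)).le
    by_contra h
    exact hx (hs t x v h).2.1

theorem stronglyMeasurable_rho : StronglyMeasurable fun p : ℝ × E3 => rho S.f p.1 p.2 := by
  refine StronglyMeasurable.integral_prod_right
    (f := fun (p : ℝ × E3) (v : E3) => S.f p.1 p.2 v) ?_
  exact (S.f_c1.continuous.comp
    (by fun_prop : Continuous fun q : (ℝ × E3) × E3 => (q.1.1, q.1.2, q.2))).stronglyMeasurable

theorem stronglyMeasurable_Efield :
    StronglyMeasurable fun p : ℝ × E3 => Efield S.f p.1 p.2 := by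
  refine StronglyMeasurable.integral_prod_right
    (f := fun (p : ℝ × E3) (y : E3) => (rho S.f p.1 y / ‖p.2 - y‖ ^ 3) • (p.2 - y)) ?_
  have h1 : StronglyMeasurable fun q : (ℝ × E3) × E3 => rho S.f q.1.1 q.2 :=
    S.stronglyMeasurable_rho.comp_measurable
      (by fun_prop : Measurable fun q : (ℝ × E3) × E3 => (q.1.1, q.2))
  have h2 : Measurable fun q : (ℝ × E3) × E3 => ‖q.1.2 - q.2‖ ^ 3 := by fun_prop
  exact (h1.measurable.div h2).stronglyMeasurable.smul
    (by fun_prop : Continuous fun q : (ℝ × E3) × E3 => q.1.2 - q.2).stronglyMeasurable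

theorem exists_Efield_decay :
    ∃ C : ℝ, 0 ≤ C ∧ ∀ t x, ‖Efield S.f t x‖ ≤ C * ((1 + ‖x‖) ^ 2)⁻¹ := by
  obtain ⟨R, r, hR0, hr, hR⟩ := S.exists_rho_bound
  obtain ⟨A, hA⟩ : ∃ A, A = ∫ v in Metric.ball (0 : E3) 1, (‖v‖ ^ 2)⁻¹ := ⟨_, rfl⟩
  have hA0 : 0 ≤ A := hA ▸ integral_nonneg fun _ => by positivity
  obtain ⟨V, hV⟩ : ∃ V, V = ∫ y : E3, (Metric.closedBall (0 : E3) r).indicator (1 : E3 → ℝ) y :=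
    ⟨_, rfl⟩
  have hI0 : ∀ y, 0 ≤ (Metric.closedBall (0 : E3) r).indicator (1 : E3 → ℝ) y :=
    fun y => indicator_nonneg (fun _ _ => zero_le_one) y
  have hV0 : 0 ≤ V := hV ▸ integral_nonneg hI0
  have hVi : Integrable ((Metric.closedBall (0 : E3) r).indicator (1 : E3 → ℝ)) :=
    (integrable_indicator_iff Metric.isClosed_closedBall.measurableSet).2
      (integrableOn_const (isCompact_closedBall _ _).measure_ne_top)
  have hnorm : ∀ t x y, ‖(rho S.f t y / ‖x - y‖ ^ 3) • (x - y)‖ ≤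
      R * (Metric.closedBall (0 : E3) r).indicator 1 y * (‖y - x‖ ^ 2)⁻¹ := fun t x y => by
    have h0 := S.rho_nonneg t y
    have : ‖(rho S.f t y / ‖x - y‖ ^ 3) • (x - y)‖ = rho S.f t y * (‖y - x‖ ^ 2)⁻¹ := by
      rw [norm_smul, Real.norm_eq_abs, abs_of_nonneg (by positivity), norm_sub_rev y x]
      rcases (norm_nonneg (x - y)).eq_or_lt' with h | h
      · rw [h]; simp
      · field_simp
    rw [this]
    exact mul_le_mul_of_nonneg_right (hR t y) (by positivity)
  have hb1 : ∀ t x, ‖Efield S.f t x‖ ≤ R * (A + V) := fun t x => by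
    have hi : Integrable ((Metric.ball x 1).indicator fun y => (‖y - x‖ ^ 2)⁻¹) :=
      (integrable_indicator_iff Metric.isOpen_ball.measurableSet).2
        (integrableOn_ball_inv_norm_sub_pow le_rfl x 1)
    have := norm_integral_le_of_norm_le ((hi.add hVi).const_mul R)
      (f := fun y : E3 => (rho S.f t y / ‖x - y‖ ^ 3) • (x - y))
      (Eventually.of_forall fun y => by
        refine (hnorm t x y).trans ?_
        rw [mul_assoc]
        refine mul_le_mul_of_nonneg_left ?_ hR0
        rw [Pi.add_apply]
        by_cases hy : y ∈ Metric.ball x 1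
        · rw [indicator_of_mem hy]
          have : (Metric.closedBall (0 : E3) r).indicator (1 : E3 → ℝ) y ≤ 1 :=
            indicator_le_self' (fun _ _ => zero_le_one) y
          exact (mul_le_of_le_one_left (by positivity) this).trans (le_add_of_nonneg_right (hI0 y))
        · rw [indicator_of_notMem hy, zero_add]
          rw [Metric.mem_ball, dist_eq_norm, not_lt] at hy
          exact mul_le_of_le_one_right (hI0 y) (inv_le_one_of_one_le₀ (one_le_pow₀ hy)))
    refine this.trans (le_of_eq ?_)
    rw [integral_const_mul]
    simp only [Pi.add_apply]
    rw [integral_add hi hVi, integral_indicator Metric.isOpen_ball.measurableSet,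
      setIntegral_ball_comp_norm_sub (fun s => (s ^ 2)⁻¹), hA, hV]
  have hb2 : ∀ t x, 2 * r + 1 ≤ ‖x‖ → ‖Efield S.f t x‖ ≤ R * V * (4 * (‖x‖ ^ 2)⁻¹) := by
    intro t x hx
    have hx0 : 0 < ‖x‖ := by linarith
    have := norm_integral_le_of_norm_le ((hVi.const_mul R).mul_const (4 * (‖x‖ ^ 2)⁻¹))
      (f := fun y : E3 => (rho S.f t y / ‖x - y‖ ^ 3) • (x - y))
      (Eventually.of_forall fun y => by
        refine (hnorm t x y).trans ?_
        by_cases hy : y ∈ Metric.closedBall (0 : E3) r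
        · refine mul_le_mul_of_nonneg_left ?_ (mul_nonneg hR0 (hI0 y))
          rw [mem_closedBall_zero_iff] at hy
          have h1 : ‖x‖ / 2 ≤ ‖y - x‖ := by
            have := norm_sub_norm_le x y
            rw [norm_sub_rev] at this
            linarith
          calc (‖y - x‖ ^ 2)⁻¹ ≤ ((‖x‖ / 2) ^ 2)⁻¹ := by gcongr
            _ = 4 * (‖x‖ ^ 2)⁻¹ := by field_simp; norm_num
        · rw [indicator_of_notMem hy]; simp)
    refine this.trans (le_of_eq ?_)
    rw [integral_mul_const, integral_const_mul, hV]
  refine ⟨R * (A + V) * (2 * r + 2) ^ 2 + R * V * 16, by positivity, fun t x => ?_⟩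
  have hx1 : 0 < 1 + ‖x‖ := by positivity
  rw [← div_eq_mul_inv, le_div_iff₀ (by positivity)]
  rcases le_total ‖x‖ (2 * r + 1) with hx | hx
  · calc ‖Efield S.f t x‖ * (1 + ‖x‖) ^ 2 ≤ (R * (A + V)) * (2 * r + 2) ^ 2 :=
          mul_le_mul (hb1 t x) (pow_le_pow_left₀ hx1.le (by linarith) 2) (by positivity)
            (by positivity)
      _ ≤ _ := le_add_of_nonneg_right (by positivity)
  · have hx0 : 0 < ‖x‖ := by linarith
    calc ‖Efield S.f t x‖ * (1 + ‖x‖) ^ 2 ≤ (R * V * (4 * (‖x‖ ^ 2)⁻¹)) * (2 * ‖x‖) ^ 2 :=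
          mul_le_mul (hb2 t x hx) (pow_le_pow_left₀ hx1.le (by linarith) 2) (by positivity)
            (by positivity)
      _ = R * V * 16 := by field_simp; ring
      _ ≤ R * (A + V) * (2 * r + 2) ^ 2 + R * V * 16 := by
          have : 0 ≤ R * (A + V) * (2 * r + 2) ^ 2 := by positivity
          linarith

theorem continuous_ξ : Continuous S.ξ := S.ξ_c2.continuous

theorem contDiff_η : ContDiff ℝ 1 S.η := by
  have h : S.η = deriv S.ξ := funext fun t => (S.ξ_ode t).deriv.symm
  rw [h]
  exact ((contDiff_succ_iff_deriv (n := 1)).1 (by exact_mod_cast S.ξ_c2)).2.2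

theorem exists_Efield_bound : ∃ C : ℝ, 0 ≤ C ∧ ∀ t x, ‖Efield S.f t x‖ ≤ C := by
  obtain ⟨C, hC0, hC⟩ := S.exists_Efield_decay
  exact ⟨C, hC0, fun t x => (hC t x).trans (mul_le_of_le_one_right hC0
    (inv_le_one_of_one_le₀ (one_le_pow₀ (by simp))))⟩

theorem stronglyMeasurable_Efield_apply (t : ℝ) : StronglyMeasurable (Efield S.f t) :=
  S.stronglyMeasurable_Efield.comp_measurable (measurable_prodMk_left (x := t))

theorem measurable_Fpt (ξ : ℝ → E3) (t : ℝ) : Measurable (Fpt ξ t) := by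
  unfold Fpt
  fun_prop

theorem integrableOn_force (t r : ℝ) :
    IntegrableOn (fun x => Efield S.f t x + Fpt S.ξ t x) (Metric.closedBall 0 r) := by
  obtain ⟨C, hC0, hC⟩ := S.exists_Efield_bound
  have h1 : IntegrableOn (Efield S.f t) (Metric.closedBall 0 r) :=
    Measure.integrableOn_of_bounded (isCompact_closedBall _ _).measure_ne_top
      (S.stronglyMeasurable_Efield_apply t).aestronglyMeasurable
      (Eventually.of_forall fun x => hC t x)
  refine h1.add ?_
  have h2 := (integrableOn_ball_inv_norm_sub_pow le_rfl (S.ξ t) (r + ‖S.ξ t‖ + 1)).mono_set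
    (s := Metric.closedBall (0 : E3) r) (fun x hx => by
      rw [mem_closedBall_zero_iff] at hx
      rw [Metric.mem_ball, dist_eq_norm]
      have := norm_sub_le x (S.ξ t)
      linarith)
  refine h2.mono' (measurable_Fpt S.ξ t).aestronglyMeasurable (Eventually.of_forall fun x => ?_)
  rw [Fpt, norm_smul, norm_inv, norm_pow, norm_norm]
  rcases (norm_nonneg (x - S.ξ t)).eq_or_lt' with h | h
  · rw [h]; simp
  · refine le_of_eq ?_
    field_simp

theorem exists_memLp_dominating_Efield {p : ℝ} (hp : 3 ≤ p) :
    ∃ D : ℝ, ∀ t, MemLp (Efield S.f t) (ENNReal.ofReal p) volume ∧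
      (eLpNorm (Efield S.f t) (ENNReal.ofReal p) volume).toReal ≤ D := by
  obtain ⟨C, hC0, hC⟩ := S.exists_Efield_decay
  have hp0 : 0 < p := by linarith
  have hg : MemLp (fun x : E3 => C * ((1 + ‖x‖) ^ 2)⁻¹) (ENNReal.ofReal p) volume := by
    refine MemLp.const_mul ?_ C
    have hm : AEStronglyMeasurable (fun x : E3 => ((1 + ‖x‖) ^ 2)⁻¹) volume := by
      have : Measurable (fun x : E3 => ((1 + ‖x‖) ^ 2)⁻¹) := by fun_prop
      exact this.aestronglyMeasurable
    rw [← integrable_norm_rpow_iff hm (by simpa using hp0) ENNReal.ofReal_ne_top,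
      ENNReal.toReal_ofReal hp0.le]
    have h := integrable_one_add_norm (E := E3) (μ := volume) (r := 2 * p)
      (by simp only [finrank_euclideanSpace, Fintype.card_fin]; push_cast; linarith)
    refine h.congr (Eventually.of_forall fun x => ?_)
    have hx : 0 < 1 + ‖x‖ := by positivity
    beta_reduce
    rw [Real.norm_of_nonneg (by positivity), Real.inv_rpow (by positivity), Real.rpow_neg hx.le,
      ← Real.rpow_natCast, ← Real.rpow_mul hx.le]
    norm_num
  refine ⟨(eLpNorm (fun x : E3 => C * ((1 + ‖x‖) ^ 2)⁻¹) (ENNReal.ofReal p) volume).toReal,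
    fun t => ⟨hg.mono' (S.stronglyMeasurable_Efield_apply t).aestronglyMeasurable
      (Eventually.of_forall (hC t)), ?_⟩⟩
  exact ENNReal.toReal_mono hg.eLpNorm_ne_top
    (eLpNorm_mono_real fun x => hC t x)

theorem integrableOn_field_norms {p : ℝ} (hp : 3 ≤ p) (a b : ℝ) :
    IntegrableOn (fun s => (eLpNorm (Efield S.f s) (ENNReal.ofReal p) volume).toReal
      + ‖Efield S.f s (S.ξ s)‖) (Icc a b) := by
  obtain ⟨C, hC0, hC⟩ := S.exists_Efield_bound
  obtain ⟨D, hD⟩ := S.exists_memLp_dominating_Efield hp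
  have hp0 : 0 < p := by linarith
  refine Measure.integrableOn_of_bounded (M := D + C) measure_Icc_lt_top.ne ?_
    (Eventually.of_forall fun s => ?_)
  · have h1 : Measurable fun s => eLpNorm (Efield S.f s) (ENNReal.ofReal p) volume := by
      simp only [eLpNorm_eq_lintegral_rpow_enorm_toReal (by simpa using hp0 : ENNReal.ofReal p ≠ 0)
        ENNReal.ofReal_ne_top]
      refine Measurable.pow_const ?_ _
      exact Measurable.lintegral_prod_right'
        (f := fun q : ℝ × E3 => ‖Efield S.f q.1 q.2‖ₑ ^ (ENNReal.ofReal p).toReal)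
        (S.stronglyMeasurable_Efield.measurable.enorm.pow_const _)
    have h2 : Measurable fun s => Efield S.f s (S.ξ s) :=
      S.stronglyMeasurable_Efield.measurable.comp
        (measurable_id.prodMk S.continuous_ξ.measurable)
    exact (h1.ennreal_toReal.add h2.norm).aestronglyMeasurable
  · rw [Real.norm_of_nonneg (by positivity)]
    exact add_le_add (hD s).2 (hC s _)

/-- The microscopic energy function of a solution. -/
abbrev h (t : ℝ) (x v : E3) : ℝ := hEnergy S.f S.ξ S.η t x v

theorem energy_nonneg : 0 ≤ energy S.f S.ξ S.η 0 := by
  have h3 : 0 ≤ ∫ x : E3, rho S.f 0 x / ‖x - S.ξ 0‖ :=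
    integral_nonneg fun x => div_nonneg (S.rho_nonneg _ _) (norm_nonneg _)
  refine mul_nonneg (by norm_num) (integral_nonneg fun p => ?_)
  refine add_nonneg (add_nonneg (mul_nonneg (by positivity) (S.f_nonneg _ _ _)) (by positivity))
    (mul_nonneg (by norm_num) (integral_nonneg fun x => integral_nonneg fun y => ?_))
  exact add_nonneg (div_nonneg (mul_nonneg (S.rho_nonneg _ _) (S.rho_nonneg _ _))
    (norm_nonneg _)) h3

theorem mass_nonneg (t : ℝ) : 0 ≤ mass S.f t := integral_nonneg fun _ => S.f_nonneg _ _ _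

theorem one_le_h (t : ℝ) (x v : E3) : 1 ≤ S.h t x v := by
  have h1 := S.energy_nonneg
  have h2 := inv_nonneg.2 (S.mass_nonneg 0)
  have : 0 ≤ ‖x - S.ξ t‖⁻¹ := by positivity
  unfold h hEnergy
  nlinarith [sq_nonneg ‖v - S.η t‖]

theorem inv_norm_le_h (t : ℝ) (x v : E3) : ‖x - S.ξ t‖⁻¹ ≤ S.h t x v := by
  have h1 := S.energy_nonneg
  have h2 := inv_nonneg.2 (S.mass_nonneg 0)
  unfold h hEnergy
  nlinarith [sq_nonneg ‖v - S.η t‖]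

theorem half_sq_norm_le_h (t : ℝ) (x v : E3) : ‖v - S.η t‖ ^ 2 / 2 ≤ S.h t x v := by
  have h1 := S.energy_nonneg
  have h2 := inv_nonneg.2 (S.mass_nonneg 0)
  have : 0 ≤ ‖x - S.ξ t‖⁻¹ := by positivity
  unfold h hEnergy
  linarith

theorem contDiffAt_h {q : ℝ × E3 × E3} (hq : q.2.1 ≠ S.ξ q.1) :
    ContDiffAt ℝ 1 (fun q : ℝ × E3 × E3 => S.h q.1 q.2.1 q.2.2) q := by
  unfold h hEnergy
  have hξ : ContDiff ℝ 1 S.ξ := S.ξ_c2.of_le (by norm_num)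
  have hη := S.contDiff_η
  have h1 : ContDiffAt ℝ 1 (fun q : ℝ × E3 × E3 => ‖q.2.1 - S.ξ q.1‖⁻¹) q :=
    ContDiffAt.inv (ContDiffAt.norm ℝ (by fun_prop) (sub_ne_zero.2 hq))
      (norm_ne_zero_iff.2 (sub_ne_zero.2 hq))
  have h2 : ContDiffAt ℝ 1 (fun q : ℝ × E3 × E3 => ‖q.2.2 - S.η q.1‖ ^ 2 / 2) q :=
    (ContDiffAt.norm_sq ℝ (by fun_prop)).div_const 2
  exact (((h2.add h1).add contDiffAt_const).add contDiffAt_const).add contDiffAt_const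

/-- The function `Ψ (h - L t)`, extended by the constant `c` to the location of the charge. -/
def weight (Ψ : ℝ → ℝ) (c L : ℝ) (q : ℝ × E3 × E3) : ℝ :=
  if q.2.1 = S.ξ q.1 then c else Ψ (S.h q.1 q.2.1 q.2.2 - L * q.1)

theorem weight_of_ne {Ψ : ℝ → ℝ} {c L : ℝ} {q : ℝ × E3 × E3} (hq : q.2.1 ≠ S.ξ q.1) :
    S.weight Ψ c L q = Ψ (S.h q.1 q.2.1 q.2.2 - L * q.1) := if_neg hq

theorem isOpen_ne_charge : IsOpen {q : ℝ × E3 × E3 | q.2.1 ≠ S.ξ q.1} :=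
  isOpen_ne_fun (by fun_prop) (S.continuous_ξ.comp continuous_fst)

theorem contDiff_weight {Ψ : ℝ → ℝ} {c L K : ℝ}
    (hΨ : ∀ t x v, ContDiffAt ℝ 1 Ψ (S.h t x v - L * t)) (hK : ∀ s, K ≤ s → Ψ s = c) :
    ContDiff ℝ 1 (S.weight Ψ c L) := by
  refine contDiff_iff_contDiffAt.2 fun q₀ => ?_
  by_cases hq : q₀.2.1 = S.ξ q₀.1
  · refine contDiffAt_const (c := c) |>.congr_of_eventuallyEq ?_
    set B := |K| + |L| * (|q₀.1| + 1) + 1 with hB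
    have hB0 : 0 < B := by positivity
    have ho : IsOpen {q : ℝ × E3 × E3 | ‖q.2.1 - S.ξ q.1‖ < B⁻¹ ∧ |q.1| < |q₀.1| + 1} := by
      have := S.continuous_ξ
      have h1 : Continuous fun q : ℝ × E3 × E3 => ‖q.2.1 - S.ξ q.1‖ := by fun_prop
      have h2 : Continuous fun q : ℝ × E3 × E3 => |q.1| := by fun_prop
      exact (isOpen_lt h1 continuous_const).inter (isOpen_lt h2 continuous_const)
    filter_upwards [ho.mem_nhds ⟨by rw [hq, sub_self, norm_zero]; positivity, by linarith⟩]
      with q hq'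
    by_cases hne : q.2.1 = S.ξ q.1
    · exact if_pos hne
    · rw [S.weight_of_ne hne]
      apply hK
      have h1 := S.inv_norm_le_h q.1 q.2.1 q.2.2
      have h0 : 0 < ‖q.2.1 - S.ξ q.1‖ := norm_pos_iff.2 (sub_ne_zero.2 hne)
      have h2 : B < ‖q.2.1 - S.ξ q.1‖⁻¹ := (lt_inv_comm₀ hB0 h0).2 hq'.1
      have h3 : L * q.1 ≤ |L| * (|q₀.1| + 1) :=
        (le_abs_self _).trans (by
          rw [abs_mul]; exact mul_le_mul_of_nonneg_left hq'.2.le (abs_nonneg _))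
      have h4 := le_abs_self K
      linarith
  · have h1 : ContDiffAt ℝ 1 (fun q : ℝ × E3 × E3 => S.h q.1 q.2.1 q.2.2 - L * q.1) q₀ :=
      (S.contDiffAt_h hq).sub (by fun_prop)
    refine (ContDiffAt.comp q₀ (hΨ q₀.1 q₀.2.1 q₀.2.2) h1).congr_of_eventuallyEq ?_
    filter_upwards [S.isOpen_ne_charge.mem_nhds hq] with q hq'
    exact S.weight_of_ne hq'

theorem fderiv_weight_apply {Ψ : ℝ → ℝ} {c L K : ℝ}
    (hΨ : ∀ t x v, ContDiffAt ℝ 1 Ψ (S.h t x v - L * t)) (hK : ∀ s, K ≤ s → Ψ s = c)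
    {t : ℝ} (ht : t ∈ Icc 0 T) {x v : E3} (hx : x ≠ S.ξ t) :
    fderiv ℝ (S.weight Ψ c L) (t, x, v) (1, v, Efield S.f t x + Fpt S.ξ t x) =
      deriv Ψ (S.h t x v - L * t) *
        (inner ℝ (v - S.η t) (Efield S.f t x - Efield S.f t (S.ξ t)) - L) := by
  set a := Efield S.f t x + Fpt S.ξ t x with ha
  have ht' : HasDerivAt (fun s : ℝ => t + s) 1 0 := (hasDerivAt_id 0).const_add t
  have hx' : HasDerivAt (fun s : ℝ => x + s • v) v 0 := by
    simpa using ((hasDerivAt_id (0 : ℝ)).smul_const v).const_add x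
  have hv' : HasDerivAt (fun s : ℝ => v + s • a) a 0 := by
    simpa using ((hasDerivAt_id (0 : ℝ)).smul_const a).const_add v
  have hγ : HasDerivAt (fun s : ℝ => (t + s, x + s • v, v + s • a)) (1, v, a) 0 :=
    ht'.prodMk (hx'.prodMk hv')
  have hw : HasFDerivAt (S.weight Ψ c L) (fderiv ℝ (S.weight Ψ c L) (t, x, v))
      (t + 0, x + (0 : ℝ) • v, v + (0 : ℝ) • a) := by
    simpa using ((S.contDiff_weight hΨ hK).differentiable one_ne_zero (t, x, v)).hasFDerivAt
  have h1 := hw.comp_hasDerivAt (0 : ℝ) hγ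
  refine h1.unique ?_
  have hξ : HasDerivAt (fun s : ℝ => S.ξ (t + s)) (S.η t) 0 := by
    have h0 : HasDerivAt S.ξ (S.η t) (t + 0) := by simpa using S.ξ_ode t
    exact h0.comp_const_add t 0
  have hη : HasDerivAt (fun s : ℝ => S.η (t + s)) (Efield S.f t (S.ξ t)) 0 := by
    have h0 : HasDerivAt S.η (Efield S.f t (S.ξ t)) (t + 0) := by simpa using S.η_ode t ht
    exact h0.comp_const_add t 0
  have hn0 : 0 < ‖x - S.ξ t‖ := norm_pos_iff.2 (sub_ne_zero.2 hx)
  have hsq : HasDerivAt (fun s : ℝ => ‖v + s • a - S.η (t + s)‖ ^ 2)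
      (2 * inner ℝ (v - S.η t) (a - Efield S.f t (S.ξ t))) 0 := by
    simpa using (hv'.sub hη).norm_sq
  have hinv : HasDerivAt (fun s : ℝ => ‖x + s • v - S.ξ (t + s)‖⁻¹)
      (-(inner ℝ (x - S.ξ t) (v - S.η t) / ‖x - S.ξ t‖ ^ 3)) 0 := by
    have h2 : HasDerivAt (fun s : ℝ => ‖x + s • v - S.ξ (t + s)‖ ^ 2)
        (2 * inner ℝ (x - S.ξ t) (v - S.η t)) 0 := by
      simpa using (hx'.sub hξ).norm_sq
    have h3 := h2.sqrt (by simpa using hn0.ne')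
    have h4 := h3.inv (by simpa using hn0.ne')
    simp only [Real.sqrt_sq (norm_nonneg _), zero_smul, add_zero] at h4
    refine h4.congr_deriv ?_
    field_simp
  have hh : HasDerivAt (fun s : ℝ => S.h (t + s) (x + s • v) (v + s • a) - L * (t + s))
      (inner ℝ (v - S.η t) (Efield S.f t x - Efield S.f t (S.ξ t)) - L) 0 := by
    have h2 := ((((hsq.div_const 2).add hinv).add_const (energy S.f S.ξ S.η 0)).add_const
      (mass S.f 0)⁻¹ |>.add_const 1).sub (ht'.const_mul L)
    refine h2.congr_deriv ?_
    rw [ha, Fpt, show Efield S.f t x + (‖x - S.ξ t‖ ^ 3)⁻¹ • (x - S.ξ t) - Efield S.f t (S.ξ t)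
      = (Efield S.f t x - Efield S.f t (S.ξ t)) + (‖x - S.ξ t‖ ^ 3)⁻¹ • (x - S.ξ t) by abel,
      inner_add_right, inner_smul_right, real_inner_comm (x - S.ξ t) (v - S.η t)]
    ring
  have hΨ' : HasDerivAt Ψ (deriv Ψ (S.h t x v - L * t))
      (S.h (t + 0) (x + (0 : ℝ) • v) (v + (0 : ℝ) • a) - L * (t + 0)) := by
    simpa using ((hΨ t x v).differentiableAt one_ne_zero).hasDerivAt
  refine (hΨ'.comp (0 : ℝ) hh).congr_of_eventuallyEq ?_
  have hcont : ContinuousAt (fun s : ℝ => (t + s, x + s • v, v + s • a)) 0 := hγ.continuousAt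
  filter_upwards [hcont.preimage_mem_nhds (S.isOpen_ne_charge.mem_nhds (by simpa using hx))]
    with s hs
  exact S.weight_of_ne hs

theorem fderiv_f_apply {t : ℝ} (ht : t ∈ Icc 0 T) {x : E3} (v : E3) (hx : x ≠ S.ξ t) :
    fderiv ℝ (fun p : ℝ × E3 × E3 => S.f p.1 p.2.1 p.2.2) (t, x, v)
      (1, v, Efield S.f t x + Fpt S.ξ t x) = 0 := by
  have hF := (S.f_c1.differentiable one_ne_zero (t, x, v)).hasFDerivAt
  have h1 := (hF.comp_hasDerivAt (f := fun τ : ℝ => (τ, x, v)) t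
    ((hasDerivAt_id t).prodMk (hasDerivAt_const t (x, v)))).deriv
  have h2 := (hF.comp (f := fun y : E3 => (t, y, v)) x
    ((hasFDerivAt_const t x).prodMk ((hasFDerivAt_id x).prodMk (hasFDerivAt_const v x)))).fderiv
  have h3 := (hF.comp (f := fun w : E3 => (t, x, w)) v
    ((hasFDerivAt_const t v).prodMk ((hasFDerivAt_const x v).prodMk (hasFDerivAt_id v)))).fderiv
  simp only [Function.comp_def] at h1 h2 h3
  have h := S.vlasov t ht x v hx
  rw [h1, h2, h3] at h
  simp only [ContinuousLinearMap.comp_apply, ContinuousLinearMap.prod_apply,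
    _root_.zero_apply, ContinuousLinearMap.id_apply] at h
  rw [← map_add, ← map_add] at h
  simpa using h

theorem continuous_f_slice (t : ℝ) : Continuous fun p : E3 × E3 => S.f t p.1 p.2 :=
  S.f_c1.continuous.comp (by fun_prop : Continuous fun p : E3 × E3 => (t, p.1, p.2))

theorem hasCompactSupport_f_slice (t : ℝ) :
    HasCompactSupport fun p : E3 × E3 => S.f t p.1 p.2 := by
  obtain ⟨M, r, -, -, -, hs⟩ := S.exists_bound_support
  refine HasCompactSupport.intro (isCompact_closedBall (0 : E3 × E3) r) fun p hp => ?_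
  by_contra hne
  have := hs t p.1 p.2 hne
  exact hp (mem_closedBall_zero_iff.2 (max_le this.2.1 this.2.2))

theorem hasDerivAt_integral_weight {Ψ β : ℝ → ℝ} {c L K : ℝ}
    (hΨ : ∀ t x v, ContDiffAt ℝ 1 Ψ (S.h t x v - L * t)) (hK : ∀ s, K ≤ s → Ψ s = c)
    (hβ : ContDiff ℝ 1 β) (hβ0 : β 0 = 0) {t : ℝ} (ht : t ∈ Icc 0 T) :
    Integrable (fun p : E3 × E3 => deriv Ψ (S.h t p.1 p.2 - L * t) *
      (inner ℝ (p.2 - S.η t) (Efield S.f t p.1 - Efield S.f t (S.ξ t)) - L)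
        * β (S.f t p.1 p.2)) ∧
    HasDerivAt (fun τ => ∫ p : E3 × E3, S.weight Ψ c L (τ, p) * β (S.f τ p.1 p.2))
      (∫ p : E3 × E3, deriv Ψ (S.h t p.1 p.2 - L * t) *
      (inner ℝ (p.2 - S.η t) (Efield S.f t p.1 - Efield S.f t (S.ξ t)) - L)
        * β (S.f t p.1 p.2)) t := by
  have hw := S.contDiff_weight hΨ hK
  have hβf : ContDiff ℝ 1 fun q : ℝ × E3 × E3 => β (S.f q.1 q.2.1 q.2.2) := hβ.comp S.f_c1
  have hc : HasCompactSupport fun q : ℝ × E3 × E3 => β (S.f q.1 q.2.1 q.2.2) :=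
    S.f_cpt.comp_left hβ0
  have key := hasDerivAt_integral_transport (hw.mul hβf) hc.mul_left
    (a := fun x => Efield S.f t x + Fpt S.ξ t x)
    ((S.stronglyMeasurable_Efield_apply t).aestronglyMeasurable.add
      (measurable_Fpt S.ξ t).aestronglyMeasurable) (S.integrableOn_force t) t
  have hae : ∀ᵐ p : E3 × E3, p.1 ≠ S.ξ t := by
    have h0 : ∀ᵐ x : E3, x ≠ S.ξ t := by simp [ae_iff]
    rw [Measure.volume_eq_prod]
    exact Measure.quasiMeasurePreserving_fst.ae h0
  have heq : (fun p : E3 × E3 => fderiv ℝ (S.weight Ψ c L * fun q : ℝ × E3 × E3 =>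
        β (S.f q.1 q.2.1 q.2.2)) (t, p) (1, p.2, Efield S.f t p.1 + Fpt S.ξ t p.1)) =ᵐ[volume]
      fun p : E3 × E3 => deriv Ψ (S.h t p.1 p.2 - L * t) *
      (inner ℝ (p.2 - S.η t) (Efield S.f t p.1 - Efield S.f t (S.ξ t)) - L)
        * β (S.f t p.1 p.2) := by
    filter_upwards [hae] with p hp
    rw [fderiv_mul (hw.differentiable one_ne_zero _) (hβf.differentiable one_ne_zero _)]
    have h1 : fderiv ℝ (fun q : ℝ × E3 × E3 => β (S.f q.1 q.2.1 q.2.2)) (t, p)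
        (1, p.2, Efield S.f t p.1 + Fpt S.ξ t p.1) = 0 := by
      have h2 := (hβ.differentiable one_ne_zero (S.f t p.1 p.2)).hasDerivAt.comp_hasFDerivAt
        (f := fun p : ℝ × E3 × E3 => S.f p.1 p.2.1 p.2.2) (t, p)
        (S.f_c1.differentiable one_ne_zero (t, p)).hasFDerivAt
      have h3 := h2.fderiv
      simp only [Function.comp_def] at h3
      rw [h3, _root_.smul_apply, S.fderiv_f_apply ht p.2 hp, smul_zero]
    rw [_root_.add_apply, _root_.smul_apply,
      _root_.smul_apply, h1, S.fderiv_weight_apply hΨ hK ht hp, smul_zero, zero_add,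
      smul_eq_mul, mul_comm]
  refine ⟨key.1.congr heq, ?_⟩
  rw [← integral_congr_ae heq]
  exact key.2

theorem weight_one (q : ℝ × E3 × E3) : S.weight (fun _ => 1) 1 0 q = 1 := by
  simp [weight]

theorem integral_comp_f_eq {β : ℝ → ℝ} (hβ : ContDiff ℝ 1 β) (hβ0 : β 0 = 0) {t : ℝ}
    (ht : t ∈ Icc 0 T) :
    ∫ p : E3 × E3, β (S.f t p.1 p.2) = ∫ p : E3 × E3, β (S.f 0 p.1 p.2) := by
  have key : ∀ s ∈ Icc (0 : ℝ) T,
      HasDerivAt (fun τ => ∫ p : E3 × E3, β (S.f τ p.1 p.2)) 0 s := fun s hs => by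
    have h := (S.hasDerivAt_integral_weight (Ψ := fun _ => 1) (c := 1) (L := 0) (K := 0)
      (fun _ _ _ => contDiffAt_const) (fun _ _ => rfl) hβ hβ0 hs).2
    simpa [weight_one] using h
  exact constant_of_has_deriv_right_zero
    (fun s hs => (key s hs).continuousAt.continuousWithinAt)
    (fun s hs => (key s (Ico_subset_Icc_self hs)).hasDerivWithinAt) t ht

theorem mass_eq {t : ℝ} (ht : t ∈ Icc 0 T) : mass S.f t = mass S.f 0 :=
  S.integral_comp_f_eq contDiff_id rfl ht

theorem integrable_f (t : ℝ) : Integrable fun p : E3 × E3 => S.f t p.1 p.2 :=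
  (S.continuous_f_slice t).integrable_of_hasCompactSupport (S.hasCompactSupport_f_slice t)

theorem f_zero_ae_le : ∀ᵐ p : E3 × E3, S.f 0 p.1 p.2 ≤ supf0 S.f := by
  obtain ⟨M, r, hM0, -, hM, -⟩ := S.exists_bound_support
  have hfin : eLpNorm (fun p : E3 × E3 => S.f 0 p.1 p.2) ⊤ volume ≠ ⊤ :=
    (memLp_top_of_bound (S.continuous_f_slice 0).aestronglyMeasurable M
      (Eventually.of_forall fun p => by
        rw [Real.norm_of_nonneg (S.f_nonneg _ _ _)]; exact hM _ _ _)).eLpNorm_ne_top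
  filter_upwards [ae_le_eLpNormEssSup (f := fun p : E3 × E3 => S.f 0 p.1 p.2)
    (μ := (volume : Measure (E3 × E3)))] with p hp
  rw [← eLpNorm_exponent_top] at hp
  have := ENNReal.toReal_mono hfin hp
  rw [toReal_enorm, Real.norm_of_nonneg (S.f_nonneg _ _ _)] at this
  exact this

theorem eq_zero_of_integral_eq_zero {g : E3 × E3 → ℝ} (hg : Continuous g)
    (hc : HasCompactSupport g) (h0 : ∀ p, 0 ≤ g p) (hi : ∫ p, g p ≤ 0) (p : E3 × E3) :
    g p = 0 := by
  have h1 : ∫ p, g p = 0 := le_antisymm hi (integral_nonneg h0)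
  rw [integral_eq_zero_iff_of_nonneg h0 (hg.integrable_of_hasCompactSupport hc),
    Measure.volume_eq_prod, Continuous.ae_eq_iff_eq _ hg continuous_zero] at h1
  exact congr_fun h1 p

theorem f_le_supf0 {t : ℝ} (ht : t ∈ Icc 0 T) (x v : E3) : S.f t x v ≤ supf0 S.f := by
  have hM : 0 ≤ supf0 S.f := ENNReal.toReal_nonneg
  set β : ℝ → ℝ := fun s => expNegInvGlue (s - supf0 S.f) with hβ
  have hβc : ContDiff ℝ 1 β := expNegInvGlue.contDiff.comp (contDiff_id.sub contDiff_const)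
  have hβ0 : β 0 = 0 := expNegInvGlue.zero_of_nonpos (by simpa using hM)
  have h := S.integral_comp_f_eq hβc hβ0 ht
  have h0 : ∫ p : E3 × E3, β (S.f 0 p.1 p.2) = 0 := by
    refine integral_eq_zero_of_ae ?_
    filter_upwards [S.f_zero_ae_le] with p hp
    exact expNegInvGlue.zero_of_nonpos (sub_nonpos.2 hp)
  have := eq_zero_of_integral_eq_zero (hβc.continuous.comp (S.continuous_f_slice t))
    ((S.hasCompactSupport_f_slice t).comp_left hβ0) (fun p => expNegInvGlue.nonneg _)
    (h.trans h0).le (x, v)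
  exact sub_nonpos.1 (expNegInvGlue.zero_iff_nonpos.1 this)

theorem exists_h_zero_bound : ∃ K, ∀ x v, S.f 0 x v ≠ 0 → x ≠ S.ξ 0 ∧ S.h 0 x v ≤ K := by
  obtain ⟨M, r, hM0, hr, hM, hs⟩ := S.exists_bound_support
  obtain ⟨ε, hε, hz⟩ := S.f0_vanishes_near_charge
  refine ⟨(r + ‖S.η 0‖) ^ 2 / 2 + ε⁻¹ + energy S.f S.ξ S.η 0 + (mass S.f 0)⁻¹ + 1,
    fun x v hne => ?_⟩
  have h1 : ε ≤ ‖x - S.ξ 0‖ := not_lt.1 fun h => hne (hz x v h)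
  refine ⟨sub_ne_zero.1 (norm_pos_iff.1 (hε.trans_le h1)), ?_⟩
  have h2 : ‖v - S.η 0‖ ≤ r + ‖S.η 0‖ :=
    (norm_sub_le _ _).trans (add_le_add_left (hs 0 x v hne).2.2 _)
  unfold h hEnergy
  gcongr

theorem exists_power_bound : ∃ L, 0 ≤ L ∧ ∀ t ∈ Icc (0 : ℝ) T, ∀ x v, S.f t x v ≠ 0 →
    inner ℝ (v - S.η t) (Efield S.f t x - Efield S.f t (S.ξ t)) ≤ L := by
  obtain ⟨M, r, hM0, hr, hM, hs⟩ := S.exists_bound_support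
  obtain ⟨C, hC0, hC⟩ := S.exists_Efield_bound
  obtain ⟨B, hB⟩ := isCompact_Icc.exists_bound_of_continuousOn
    (s := Icc (0 : ℝ) T) S.contDiff_η.continuous.continuousOn
  have hB0 : 0 ≤ B := (norm_nonneg _).trans (hB 0 (left_mem_Icc.2 S.T_pos.le))
  refine ⟨(r + B) * (C + C), by positivity, fun t ht x v hne => ?_⟩
  refine (real_inner_le_norm _ _).trans (mul_le_mul ?_ ?_ (norm_nonneg _) (by positivity))
  · exact (norm_sub_le _ _).trans (add_le_add (hs t x v hne).2.2 (hB t ht))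
  · exact (norm_sub_le _ _).trans (add_le_add (hC t x) (hC t _))

theorem exists_h_bound : ∃ K, ∀ t ∈ Icc (0 : ℝ) T, ∀ x v, S.f t x v ≠ 0 →
    x ≠ S.ξ t ∧ S.h t x v ≤ K := by
  obtain ⟨K, hK⟩ := S.exists_h_zero_bound
  obtain ⟨L, hL0, hL⟩ := S.exists_power_bound
  set Ψ : ℝ → ℝ := fun s => Real.smoothTransition (s - K) with hΨ
  have hΨc : ContDiff ℝ 1 Ψ := Real.smoothTransition.contDiff.comp (contDiff_id.sub contDiff_const)
  have hΨm : Monotone Ψ := fun a b hab => Real.smoothTransition.monotone (sub_le_sub_right hab K)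
  have hΨ1 : ∀ s, K + 1 ≤ s → Ψ s = 1 := fun s hs =>
    Real.smoothTransition.one_of_one_le (by linarith)
  have hΨa : ∀ t x v, ContDiffAt ℝ 1 Ψ (S.h t x v - L * t) := fun _ _ _ => hΨc.contDiffAt
  have hw0 : ∀ q, 0 ≤ S.weight Ψ 1 L q := fun q => by
    unfold weight
    split_ifs
    exacts [zero_le_one, Real.smoothTransition.nonneg _]
  set J : ℝ → ℝ := fun τ => ∫ p : E3 × E3, S.weight Ψ 1 L (τ, p) * S.f τ p.1 p.2 with hJ
  have hder := fun t (ht : t ∈ Icc (0 : ℝ) T) =>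
    (S.hasDerivAt_integral_weight hΨa hΨ1 contDiff_id rfl ht).2
  have hanti : AntitoneOn J (Icc 0 T) := by
    refine antitoneOn_of_hasDerivWithinAt_nonpos (convex_Icc 0 T)
      (fun t ht => (hder t ht).continuousAt.continuousWithinAt)
      (fun t ht => (hder t (interior_subset ht)).hasDerivWithinAt) (fun t ht => ?_)
    refine integral_nonpos fun p => ?_
    by_cases hne : S.f t p.1 p.2 = 0
    · simp [hne]
    · refine mul_nonpos_of_nonpos_of_nonneg (mul_nonpos_of_nonneg_of_nonpos ?_ ?_)
        (S.f_nonneg _ _ _)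
      · exact hΨm.deriv_nonneg
      · exact sub_nonpos.2 (hL t (interior_subset ht) _ _ hne)
  have hJ0 : J 0 = 0 := by
    refine integral_eq_zero_of_ae (Eventually.of_forall fun p => ?_)
    by_cases hne : S.f 0 p.1 p.2 = 0
    · simp [hne]
    · have h1 := hK p.1 p.2 hne
      have h2 : S.weight Ψ 1 L (0, p) = 0 := by
        rw [S.weight_of_ne (q := (0, p)) h1.1]
        exact Real.smoothTransition.zero_of_nonpos (by simpa using h1.2)
      simp [h2]
  refine ⟨K + L * T, fun t ht x v hne => ?_⟩
  have hJt : J t ≤ 0 := hJ0 ▸ hanti (left_mem_Icc.2 S.T_pos.le) ht ht.1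
  have hwc : Continuous fun p : E3 × E3 => S.weight Ψ 1 L (t, p) :=
    (S.contDiff_weight hΨa hΨ1).continuous.comp (by fun_prop)
  have := eq_zero_of_integral_eq_zero (hwc.mul (S.continuous_f_slice t))
    (S.hasCompactSupport_f_slice t).mul_left
    (fun p => mul_nonneg (hw0 _) (S.f_nonneg _ _ _)) hJt (x, v)
  have hw : S.weight Ψ 1 L (t, x, v) = 0 := (mul_eq_zero.1 this).resolve_right hne
  have hx : x ≠ S.ξ t := fun hx => by
    rw [weight, if_pos hx] at hw
    exact one_ne_zero hw
  refine ⟨hx, ?_⟩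
  rw [S.weight_of_ne (q := (t, x, v)) hx] at hw
  have h1 := Real.smoothTransition.zero_iff_nonpos.1 hw
  have h2 : L * t ≤ L * T := mul_le_mul_of_nonneg_left ht.2 hL0
  simp only at h1
  linarith

theorem exists_hasDerivAt_Htilde (k : ℝ) : ∃ I : ℝ → ℝ, ∀ t ∈ Icc (0 : ℝ) T,
    I t = Htilde S.f S.ξ S.η k t ∧
    Integrable (fun p : E3 × E3 => S.h t p.1 p.2 ^ (k / 2) * S.f t p.1 p.2) ∧
    HasDerivAt I (∫ p : E3 × E3, k / 2 * S.h t p.1 p.2 ^ (k / 2 - 1) *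
      inner ℝ (p.2 - S.η t) (Efield S.f t p.1 - Efield S.f t (S.ξ t)) * S.f t p.1 p.2) t := by
  obtain ⟨K, hK⟩ := S.exists_h_bound
  set Ψ : ℝ → ℝ := fun s => s ^ (k / 2) * (1 - Real.smoothTransition (s - (K + 1))) with hΨ
  have hΨ0 : ∀ s, K + 2 ≤ s → Ψ s = 0 := fun s hs => by
    simp only [hΨ]
    rw [Real.smoothTransition.one_of_one_le (by linarith), sub_self, mul_zero]
  have hΨ1 : ∀ s, s ≤ K + 1 → Ψ s = s ^ (k / 2) := fun s hs => by
    simp only [hΨ]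
    rw [Real.smoothTransition.zero_of_nonpos (by linarith), sub_zero, mul_one]
  have hΨa : ∀ t x v, ContDiffAt ℝ 1 Ψ (S.h t x v - 0 * t) := fun t x v => by
    have h1 : S.h t x v - 0 * t ≠ 0 := by linarith [S.one_le_h t x v]
    refine (Real.contDiffAt_rpow_const_of_ne h1).mul (contDiffAt_const.sub ?_)
    exact (Real.smoothTransition.contDiff.comp (contDiff_id.sub contDiff_const)).contDiffAt
  have hw : ∀ t ∈ Icc (0 : ℝ) T, ∀ p : E3 × E3, S.weight Ψ 0 0 (t, p) * S.f t p.1 p.2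
      = S.h t p.1 p.2 ^ (k / 2) * S.f t p.1 p.2 := fun t ht p => by
    by_cases hne : S.f t p.1 p.2 = 0
    · simp [hne]
    · have h1 := hK t ht p.1 p.2 hne
      rw [S.weight_of_ne (q := (t, p)) h1.1, hΨ1 _ (by linarith [h1.2]), zero_mul, sub_zero]
  refine ⟨fun τ => ∫ p : E3 × E3, S.weight Ψ 0 0 (τ, p) * S.f τ p.1 p.2, fun t ht =>
    ⟨integral_congr_ae (Eventually.of_forall (hw t ht)), ?_, ?_⟩⟩
  · have hwc : Continuous fun p : E3 × E3 => S.weight Ψ 0 0 (t, p) :=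
      (S.contDiff_weight hΨa hΨ0).continuous.comp (by fun_prop)
    exact ((hwc.mul (S.continuous_f_slice t)).integrable_of_hasCompactSupport
      (S.hasCompactSupport_f_slice t).mul_left).congr (Eventually.of_forall (hw t ht))
  · refine (S.hasDerivAt_integral_weight hΨa hΨ0 contDiff_id rfl ht).2.congr_deriv ?_
    refine integral_congr_ae (Eventually.of_forall fun p => ?_)
    by_cases hne : S.f t p.1 p.2 = 0
    · simp [hne]
    · have h1 := hK t ht p.1 p.2 hne
      have h2 : deriv Ψ (S.h t p.1 p.2 - 0 * t) = k / 2 * S.h t p.1 p.2 ^ (k / 2 - 1) := by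
        rw [zero_mul, sub_zero]
        have h3 : Ψ =ᶠ[nhds (S.h t p.1 p.2)] fun s => s ^ (k / 2) := by
          filter_upwards [Iio_mem_nhds (show S.h t p.1 p.2 < K + 1 by linarith [h1.2])] with s hs
          exact hΨ1 s (le_of_lt hs)
        rw [h3.deriv_eq]
        exact (Real.hasDerivAt_rpow_const
          (Or.inl (by linarith [S.one_le_h t p.1 p.2]))).deriv
      simp only [h2, sub_zero, id]

end VPClassicalSolution

theorem integral_rpow_mul_rpow_le {X : Type*} [MeasurableSpace X] {μ : Measure X} {α θ : ℝ}
    (hα : 0 < α) (hθ : 0 < θ) (h : α + θ = 1) {A B : X → ℝ} (hA : Integrable A μ)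
    (hB : Integrable B μ) (hA0 : ∀ x, 0 ≤ A x) (hB0 : ∀ x, 0 ≤ B x) :
    Integrable (fun x => A x ^ α * B x ^ θ) μ ∧
      ∫ x, A x ^ α * B x ^ θ ∂μ ≤ (∫ x, A x ∂μ) ^ α * (∫ x, B x ∂μ) ^ θ := by
  have key : ∀ {γ : ℝ} {F : X → ℝ}, 0 < γ → Integrable F μ → (∀ x, 0 ≤ F x) →
      MemLp (fun x => F x ^ γ) (ENNReal.ofReal (1 / γ)) μ := fun {γ F} hγ hF hF0 => by
    have hγ' : 0 < 1 / γ := by positivity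
    refine (integrable_norm_rpow_iff (hF.aemeasurable.pow_const γ).aestronglyMeasurable
      (by simpa using hγ') ENNReal.ofReal_ne_top).1 (hF.congr (Eventually.of_forall fun x => ?_))
    simp only
    rw [ENNReal.toReal_ofReal hγ'.le, Real.norm_of_nonneg (Real.rpow_nonneg (hF0 x) _),
      ← Real.rpow_mul (hF0 x), mul_one_div_cancel hγ.ne', Real.rpow_one]
  have hpow : ∀ {γ : ℝ} {F : X → ℝ}, 0 < γ → (∀ x, 0 ≤ F x) →
      (∫ x, (F x ^ γ) ^ (1 / γ) ∂μ) ^ (1 / (1 / γ)) = (∫ x, F x ∂μ) ^ γ := fun {γ F} hγ hF0 => by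
    simp only [← Real.rpow_mul (hF0 _), mul_one_div_cancel hγ.ne', Real.rpow_one, one_div_one_div]
  refine ⟨?_, ?_⟩
  · refine (hA.add hB).mono' ((hA.aemeasurable.pow_const α).mul
      (hB.aemeasurable.pow_const θ)).aestronglyMeasurable (Eventually.of_forall fun x => ?_)
    have h1 := hA0 x
    have h2 := hB0 x
    rw [Real.norm_of_nonneg (by positivity)]
    refine (Real.geom_mean_le_arith_mean2_weighted hα.le hθ.le h1 h2 h).trans ?_
    exact add_le_add (mul_le_of_le_one_left h1 (by linarith))
      (mul_le_of_le_one_left h2 (by linarith))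
  · have hpq : (1 / α).HolderConjugate (1 / θ) := by
      rw [Real.holderConjugate_iff]
      exact ⟨by rw [lt_div_iff₀ hα]; linarith, by simpa using h⟩
    have := integral_mul_le_Lp_mul_Lq_of_nonneg hpq
      (Eventually.of_forall fun x => Real.rpow_nonneg (hA0 x) α)
      (Eventually.of_forall fun x => Real.rpow_nonneg (hB0 x) θ) (key hα hA hA0) (key hθ hB hB0)
    rwa [hpow hα hA0, hpow hθ hB0] at this

theorem integral_rpow_mul_inv_sqrt_le {a : E3} {w φ : E3 → ℝ} {M k : ℝ} (hk : 0 ≤ k)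
    (hw1 : ∀ v, 1 ≤ w v) (hw : ∀ v, ‖v - a‖ ^ 2 / 2 ≤ w v) (hφ0 : ∀ v, 0 ≤ φ v)
    (hφM : ∀ v, φ v ≤ M) (hi : Integrable fun v => w v ^ (k / 2) * φ v) :
    ∫ v, w v ^ (k / 2) * (√(w v))⁻¹ * φ v ≤
      (18 * ballInvNormIntegral * M + 1) * (∫ v, w v ^ (k / 2) * φ v) ^ ((k + 2) / (k + 3)) := by
  set n := ∫ v, w v ^ (k / 2) * φ v with hn
  have hM0 : 0 ≤ M := (hφ0 0).trans (hφM 0)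
  have hwk : ∀ v, 0 ≤ w v ^ (k / 2) := fun v => Real.rpow_nonneg (by linarith [hw1 v]) _
  have hg0 : ∀ v, 0 ≤ w v ^ (k / 2) * (√(w v))⁻¹ * φ v := fun v =>
    mul_nonneg (mul_nonneg (hwk v) (by positivity)) (hφ0 v)
  have hs1 : ∀ v, 1 ≤ √(w v) := fun v => Real.one_le_sqrt.2 (hw1 v)
  have hn0 : 0 ≤ n := integral_nonneg fun v => mul_nonneg (hwk v) (hφ0 v)
  rcases hn0.eq_or_lt with hn0' | hnpos
  · rw [← hn0', Real.zero_rpow (by positivity), mul_zero, hn0']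
    refine integral_mono_of_nonneg (Eventually.of_forall hg0) hi (Eventually.of_forall fun v => ?_)
    exact mul_le_mul_of_nonneg_right
      (mul_le_of_le_one_right (hwk v) (inv_le_one_of_one_le₀ (hs1 v))) (hφ0 v)
  set R := n ^ (1 / (k + 3)) with hR
  have hRpos : 0 < R := Real.rpow_pos_of_pos hnpos _
  have hsq : ∀ v, ‖v - a‖ ≤ 2 * √(w v) := fun v => by
    refine abs_le_of_sq_le_sq' ?_ (by positivity) |>.2
    rw [mul_pow, Real.sq_sqrt (by linarith [hw1 v])]
    linarith [hw v, hw1 v]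
  have hball : Integrable
      ((Metric.ball a (3 * R)).indicator fun v => M * R ^ k * 2 * ‖v - a‖⁻¹) := by
    refine IntegrableOn.integrable_indicator (Integrable.const_mul ?_ _)
      Metric.isOpen_ball.measurableSet
    simpa [IntegrableOn] using integrableOn_ball_inv_norm_sub_pow (n := 1) (by norm_num) a (3 * R)
  have hwR : ∀ v, w v ^ (k / 2) = √(w v) ^ k := fun v => by
    rw [Real.sqrt_eq_rpow, ← Real.rpow_mul (by linarith [hw1 v]), one_div_mul_eq_div]
  have hae : ∀ᵐ v : E3, v ≠ a := by simp [ae_iff]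
  calc ∫ v, w v ^ (k / 2) * (√(w v))⁻¹ * φ v
      ≤ ∫ v, ((Metric.ball a (3 * R)).indicator (fun v => M * R ^ k * 2 * ‖v - a‖⁻¹) v
          + R⁻¹ * (w v ^ (k / 2) * φ v)) := by
        refine integral_mono_of_nonneg (Eventually.of_forall hg0)
          (hball.add (hi.const_mul _)) ?_
        filter_upwards [hae] with v hv
        have hva : 0 < ‖v - a‖ := norm_pos_iff.2 (sub_ne_zero.2 hv)
        have hs0 : 0 < √(w v) := zero_lt_one.trans_le (hs1 v)
        have h2 : 0 ≤ w v ^ (k / 2) * φ v := mul_nonneg (hwk v) (hφ0 v)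
        rcases le_or_gt (√(w v)) R with hle | hlt
        · have hmem : v ∈ Metric.ball a (3 * R) := by
            rw [Metric.mem_ball, dist_eq_norm]
            linarith [hsq v]
          rw [indicator_of_mem hmem]
          refine le_add_of_le_of_nonneg ?_ (by positivity)
          have h3 : (√(w v))⁻¹ ≤ 2 * ‖v - a‖⁻¹ := by
            rw [← div_eq_mul_inv, le_div_iff₀ hva, inv_mul_le_iff₀ hs0]
            linarith [hsq v]
          have h4 : w v ^ (k / 2) ≤ R ^ k := hwR v ▸ Real.rpow_le_rpow hs0.le hle hk
          calc w v ^ (k / 2) * (√(w v))⁻¹ * φ v ≤ R ^ k * (2 * ‖v - a‖⁻¹) * M := by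
                gcongr
                exacts [hφ0 v, hφM v]
            _ = M * R ^ k * 2 * ‖v - a‖⁻¹ := by ring
        · refine le_add_of_nonneg_of_le (indicator_nonneg (fun v _ => by positivity) v) ?_
          have h3 : (√(w v))⁻¹ ≤ R⁻¹ := inv_anti₀ hRpos hlt.le
          calc w v ^ (k / 2) * (√(w v))⁻¹ * φ v = (√(w v))⁻¹ * (w v ^ (k / 2) * φ v) := by ring
            _ ≤ _ := mul_le_mul_of_nonneg_right h3 h2
    _ = M * R ^ k * 2 * (ballInvNormIntegral * (3 * R) ^ 2) + R⁻¹ * n := by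
        rw [integral_add hball (hi.const_mul _),
          integral_indicator Metric.isOpen_ball.measurableSet, integral_const_mul,
          integral_const_mul, setIntegral_ball_inv_norm_sub a (by positivity)]
    _ = (18 * ballInvNormIntegral * M + 1) * n ^ ((k + 2) / (k + 3)) := by
        have h3 : R ^ (k + 2) = n ^ ((k + 2) / (k + 3)) := by
          rw [hR, ← Real.rpow_mul hn0, one_div_mul_eq_div]
        have h4 : R ^ k * R ^ 2 = R ^ (k + 2) := by
          rw [Real.rpow_add hRpos, Real.rpow_two]
        have h5 : R⁻¹ * n = R ^ (k + 2) := by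
          have h6 : n = R ^ (k + 3) := by
            rw [hR, ← Real.rpow_mul hn0, one_div_mul_cancel (by positivity), Real.rpow_one]
          rw [inv_mul_eq_iff_eq_mul₀ hRpos.ne', ← Real.rpow_one_add' hRpos.le (by positivity)]
          rw [h6]
          ring_nf
        rw [← h3, h5, ← h4]
        ring

/-- The constant in the differential inequality for the energy moment of order `k`, in terms of
the mass `m` and a bound `s` on the density. -/
def momentConst (k m s : ℝ) : ℝ :=
  |k| * (18 * ballInvNormIntegral * |s| + 1 + |m| ^ (1 / (k + 3)))

theorem momentConst_nonneg (k m s : ℝ) : 0 ≤ momentConst k m s := by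
  have := ballInvNormIntegral_nonneg
  unfold momentConst
  positivity

namespace VPClassicalSolution

variable {T : ℝ} (S : VPClassicalSolution T)

theorem stronglyMeasurable_h (t : ℝ) : StronglyMeasurable fun p : E3 × E3 => S.h t p.1 p.2 := by
  unfold h hEnergy
  exact Measurable.stronglyMeasurable (by fun_prop)

theorem integral_h_rpow_mul_inv_sqrt_le {k : ℝ} (hk : 0 ≤ k) {t : ℝ} (ht : t ∈ Icc 0 T)
    (hG : Integrable fun p : E3 × E3 => S.h t p.1 p.2 ^ (k / 2) * S.f t p.1 p.2) :
    ∫ p : E3 × E3, S.h t p.1 p.2 ^ (k / 2) * (√(S.h t p.1 p.2))⁻¹ * S.f t p.1 p.2 ≤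
      mass S.f 0 ^ (1 / (k + 3)) * Htilde S.f S.ξ S.η k t ^ ((k + 2) / (k + 3)) := by
  have hh0 : ∀ p : E3 × E3, 0 ≤ S.h t p.1 p.2 := fun p => by linarith [S.one_le_h t p.1 p.2]
  have hG0 : ∀ p : E3 × E3, 0 ≤ S.h t p.1 p.2 ^ (k / 2) * S.f t p.1 p.2 := fun p =>
    mul_nonneg (Real.rpow_nonneg (hh0 p) _) (S.f_nonneg _ _ _)
  have H := integral_rpow_mul_rpow_le (α := 1 / (k + 3)) (θ := (k + 2) / (k + 3))
    (by positivity) (by positivity) (by field_simp; ring) (S.integrable_f t) hG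
    (fun p => S.f_nonneg _ _ _) hG0
  rw [← S.mass_eq ht]
  refine (integral_mono_of_nonneg (Eventually.of_forall fun p => ?_) H.1
    (Eventually.of_forall fun p => ?_)).trans H.2
  · exact mul_nonneg (mul_nonneg (Real.rpow_nonneg (hh0 p) _) (by positivity)) (S.f_nonneg _ _ _)
  · have hf := S.f_nonneg t p.1 p.2
    simp only
    rw [Real.mul_rpow (Real.rpow_nonneg (hh0 p) _) hf, mul_left_comm, ← Real.rpow_mul (hh0 p)]
    have h1 : S.f t p.1 p.2 ^ (1 / (k + 3)) * S.f t p.1 p.2 ^ ((k + 2) / (k + 3))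
        = S.f t p.1 p.2 := by
      rw [← Real.rpow_add_of_nonneg hf (by positivity) (by positivity), ← add_div,
        show 1 + (k + 2) = k + 3 by ring, div_self (by positivity), Real.rpow_one]
    rw [h1, Real.sqrt_eq_rpow, ← Real.rpow_neg (hh0 p),
      ← Real.rpow_add (zero_lt_one.trans_le (S.one_le_h t p.1 p.2))]
    refine mul_le_mul_of_nonneg_right ?_ hf
    refine Real.rpow_le_rpow_of_exponent_le (S.one_le_h t p.1 p.2) ?_
    rw [div_mul_div_comm, le_div_iff₀ (by positivity)]
    nlinarith

theorem integral_norm_Efield_mul_le {k : ℝ} (hk : 0 ≤ k) {t : ℝ} (ht : t ∈ Icc 0 T)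
    (hG : Integrable fun p : E3 × E3 => S.h t p.1 p.2 ^ (k / 2) * S.f t p.1 p.2)
    (hg : Integrable fun p : E3 × E3 => ‖Efield S.f t p.1‖ *
      (S.h t p.1 p.2 ^ (k / 2) * (√(S.h t p.1 p.2))⁻¹ * S.f t p.1 p.2)) :
    ∫ p : E3 × E3, ‖Efield S.f t p.1‖ *
        (S.h t p.1 p.2 ^ (k / 2) * (√(S.h t p.1 p.2))⁻¹ * S.f t p.1 p.2) ≤
      (18 * ballInvNormIntegral * supf0 S.f + 1) *
        (eLpNorm (Efield S.f t) (ENNReal.ofReal (k + 3)) volume).toReal *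
        Htilde S.f S.ξ S.η k t ^ ((k + 2) / (k + 3)) := by
  obtain ⟨D, hD⟩ := S.exists_memLp_dominating_Efield (p := k + 3) (by linarith)
  have hp : (ENNReal.ofReal (k + 3)) ≠ 0 := by simp; linarith
  have hE := (hD t).1
  have hEi : Integrable fun x => ‖Efield S.f t x‖ ^ (k + 3) := by
    have := hE.integrable_norm_rpow hp ENNReal.ofReal_ne_top
    rwa [ENNReal.toReal_ofReal (by positivity)] at this
  have hh0 : ∀ x v, 0 ≤ S.h t x v := fun x v => by linarith [S.one_le_h t x v]
  have hG0 : ∀ x v, 0 ≤ S.h t x v ^ (k / 2) * S.f t x v := fun x v =>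
    mul_nonneg (Real.rpow_nonneg (hh0 x v) _) (S.f_nonneg _ _ _)
  have hg0 : ∀ x v, 0 ≤ S.h t x v ^ (k / 2) * (√(S.h t x v))⁻¹ * S.f t x v := fun x v =>
    mul_nonneg (mul_nonneg (Real.rpow_nonneg (hh0 x v) _) (by positivity)) (S.f_nonneg _ _ _)
  have hc : 0 ≤ 18 * ballInvNormIntegral * supf0 S.f + 1 := by
    have h1 := ballInvNormIntegral_nonneg
    have h2 : 0 ≤ supf0 S.f := ENNReal.toReal_nonneg
    positivity
  rw [Measure.volume_eq_prod] at hG hg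
  have H := integral_rpow_mul_rpow_le (α := 1 / (k + 3)) (θ := (k + 2) / (k + 3))
    (by positivity) (by positivity) (by field_simp; ring) hEi hG.integral_prod_left
    (fun x => by positivity) (fun x => integral_nonneg (hG0 x))
  have hL : (eLpNorm (Efield S.f t) (ENNReal.ofReal (k + 3)) volume).toReal
      = (∫ x, ‖Efield S.f t x‖ ^ (k + 3)) ^ (1 / (k + 3)) := by
    rw [hE.eLpNorm_eq_integral_rpow_norm hp ENNReal.ofReal_ne_top,
      ENNReal.toReal_ofReal (by positivity), ENNReal.toReal_ofReal (by positivity),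
      one_div]
  rw [Measure.volume_eq_prod, integral_prod _ hg, mul_assoc, hL, Htilde,
    Measure.volume_eq_prod, integral_prod _ hG]
  refine le_trans ?_ (mul_le_mul_of_nonneg_left H.2 hc)
  rw [← integral_const_mul]
  refine integral_mono_of_nonneg (Eventually.of_forall fun x => integral_nonneg fun v =>
    mul_nonneg (norm_nonneg _) (hg0 x v)) (H.1.const_mul _) ?_
  filter_upwards [hG.prod_right_ae] with x hx
  rw [integral_const_mul, ← Real.rpow_mul (norm_nonneg _), mul_one_div_cancel (by positivity),
    Real.rpow_one, mul_left_comm]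
  refine mul_le_mul_of_nonneg_left ?_ (norm_nonneg _)
  exact integral_rpow_mul_inv_sqrt_le hk (S.one_le_h t x) (S.half_sq_norm_le_h t x)
    (S.f_nonneg t x) (S.f_le_supf0 ht x) hx

theorem deriv_integral_le {k : ℝ} (hk : 0 ≤ k) {t : ℝ} (ht : t ∈ Icc 0 T)
    (hG : Integrable fun p : E3 × E3 => S.h t p.1 p.2 ^ (k / 2) * S.f t p.1 p.2) :
    ∫ p : E3 × E3, k / 2 * S.h t p.1 p.2 ^ (k / 2 - 1) *
      inner ℝ (p.2 - S.η t) (Efield S.f t p.1 - Efield S.f t (S.ξ t)) * S.f t p.1 p.2 ≤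
      momentConst k (mass S.f 0) (supf0 S.f) *
        ((eLpNorm (Efield S.f t) (ENNReal.ofReal (k + 3)) volume).toReal
          + ‖Efield S.f t (S.ξ t)‖) * Htilde S.f S.ξ S.η k t ^ ((k + 2) / (k + 3)) := by
  set g : E3 × E3 → ℝ := fun p =>
    S.h t p.1 p.2 ^ (k / 2) * (√(S.h t p.1 p.2))⁻¹ * S.f t p.1 p.2 with hgdef
  have hh1 : ∀ p : E3 × E3, 1 ≤ S.h t p.1 p.2 := fun p => S.one_le_h t p.1 p.2
  have hh0 : ∀ p : E3 × E3, 0 < S.h t p.1 p.2 := fun p => zero_lt_one.trans_le (hh1 p)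
  have hg0 : ∀ p, 0 ≤ g p := fun p => mul_nonneg (mul_nonneg (Real.rpow_nonneg (hh0 p).le _)
    (by positivity)) (S.f_nonneg _ _ _)
  have hg : Integrable g := by
    refine hG.mono' ?_ (Eventually.of_forall fun p => ?_)
    · have h1 := (S.stronglyMeasurable_h t).measurable
      have h2 := (S.continuous_f_slice t).measurable
      exact (((h1.pow_const _).mul (h1.sqrt).inv).mul h2).aestronglyMeasurable
    · rw [Real.norm_of_nonneg (hg0 p)]
      exact mul_le_mul_of_nonneg_right (mul_le_of_le_one_right (Real.rpow_nonneg (hh0 p).le _)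
        (inv_le_one_of_one_le₀ (Real.one_le_sqrt.2 (hh1 p)))) (S.f_nonneg _ _ _)
  obtain ⟨C, hC0, hC⟩ := S.exists_Efield_bound
  have hEg : Integrable fun p : E3 × E3 => ‖Efield S.f t p.1‖ * g p := by
    refine hg.bdd_mul (c := C) ?_ (Eventually.of_forall fun p => ?_)
    · exact ((S.stronglyMeasurable_Efield_apply t).measurable.comp
        measurable_fst).norm.aestronglyMeasurable
    · simpa using hC t p.1
  have hm := S.mass_nonneg 0
  have hs : 0 ≤ supf0 S.f := ENNReal.toReal_nonneg
  have hc := ballInvNormIntegral_nonneg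
  have hpt : ∀ p : E3 × E3, k / 2 * S.h t p.1 p.2 ^ (k / 2 - 1) *
      inner ℝ (p.2 - S.η t) (Efield S.f t p.1 - Efield S.f t (S.ξ t)) * S.f t p.1 p.2 ≤
      k * (‖Efield S.f t p.1‖ * g p + ‖Efield S.f t (S.ξ t)‖ * g p) := fun p => by
    have hs0 : 0 < √(S.h t p.1 p.2) := Real.sqrt_pos.2 (hh0 p)
    have h1 : ‖p.2 - S.η t‖ ≤ 2 * √(S.h t p.1 p.2) := by
      refine abs_le_of_sq_le_sq' ?_ (by positivity) |>.2
      rw [mul_pow, Real.sq_sqrt (hh0 p).le]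
      linarith [S.half_sq_norm_le_h t p.1 p.2, hh0 p]
    have h2 : inner ℝ (p.2 - S.η t) (Efield S.f t p.1 - Efield S.f t (S.ξ t)) ≤
        2 * √(S.h t p.1 p.2) * (‖Efield S.f t p.1‖ + ‖Efield S.f t (S.ξ t)‖) :=
      (real_inner_le_norm _ _).trans (mul_le_mul h1 (norm_sub_le _ _) (norm_nonneg _)
        (by positivity))
    have h3 : S.h t p.1 p.2 ^ (k / 2 - 1) * √(S.h t p.1 p.2)
        = S.h t p.1 p.2 ^ (k / 2) * (√(S.h t p.1 p.2))⁻¹ := by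
      rw [Real.rpow_sub_one (hh0 p).ne', div_mul_eq_mul_div, mul_div_assoc, Real.sqrt_div_self]
    have h4 : 0 ≤ k / 2 * S.h t p.1 p.2 ^ (k / 2 - 1) :=
      mul_nonneg (by positivity) (Real.rpow_nonneg (hh0 p).le _)
    refine (mul_le_mul_of_nonneg_right (mul_le_mul_of_nonneg_left h2 h4)
      (S.f_nonneg _ _ _)).trans_eq ?_
    simp only [hgdef]
    rw [← h3]
    ring
  have hae : (∫ p : E3 × E3, k / 2 * S.h t p.1 p.2 ^ (k / 2 - 1) *
      inner ℝ (p.2 - S.η t) (Efield S.f t p.1 - Efield S.f t (S.ξ t)) * S.f t p.1 p.2) ≤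
      k * ((∫ p, ‖Efield S.f t p.1‖ * g p) + ‖Efield S.f t (S.ξ t)‖ * ∫ p, g p) := by
    rw [← integral_const_mul, ← integral_add hEg (hg.const_mul _), ← integral_const_mul]
    by_cases hi : Integrable fun p : E3 × E3 => k / 2 * S.h t p.1 p.2 ^ (k / 2 - 1) *
      inner ℝ (p.2 - S.η t) (Efield S.f t p.1 - Efield S.f t (S.ξ t)) * S.f t p.1 p.2
    · exact integral_mono hi ((hEg.add (hg.const_mul _)).const_mul _) hpt
    · rw [integral_undef hi]
      exact integral_nonneg fun p => mul_nonneg hk (add_nonneg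
        (mul_nonneg (norm_nonneg _) (hg0 p)) (mul_nonneg (norm_nonneg _) (hg0 p)))
  refine hae.trans ?_
  have h1 := S.integral_norm_Efield_mul_le hk ht hG hEg
  have h2 := S.integral_h_rpow_mul_inv_sqrt_le hk ht hG
  rw [momentConst, abs_of_nonneg hk, abs_of_nonneg hm, abs_of_nonneg hs, mul_assoc, mul_assoc]
  refine mul_le_mul_of_nonneg_left ?_ hk
  have h3 : 0 ≤ Htilde S.f S.ξ S.η k t ^ ((k + 2) / (k + 3)) := Real.rpow_nonneg
    (integral_nonneg fun p => mul_nonneg (Real.rpow_nonneg (hh0 p).le _) (S.f_nonneg _ _ _)) _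
  have h4 : 0 ≤ (eLpNorm (Efield S.f t) (ENNReal.ofReal (k + 3)) volume).toReal :=
    ENNReal.toReal_nonneg
  have h5 := norm_nonneg (Efield S.f t (S.ξ t))
  have h6 : 0 ≤ mass S.f 0 ^ (1 / (k + 3)) := Real.rpow_nonneg hm _
  have h7 := mul_le_mul_of_nonneg_left h2 h5
  have h8 : 0 ≤ 18 * ballInvNormIntegral * supf0 S.f + 1 := by positivity
  have h9 := mul_nonneg (mul_nonneg h6 h4) h3
  have h10 := mul_nonneg (mul_nonneg h8 h5) h3
  refine (add_le_add h1 h7).trans ?_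
  linear_combination h9 + h10

theorem Htilde_nonneg (k t : ℝ) : 0 ≤ Htilde S.f S.ξ S.η k t :=
  integral_nonneg fun p => mul_nonneg
    (Real.rpow_nonneg (by linarith [S.one_le_h t p.1 p.2]) _) (S.f_nonneg _ _ _)

theorem Hmom_nonneg (k t : ℝ) : 0 ≤ Hmom S.f S.ξ S.η k t :=
  Real.sSup_nonneg (by rintro _ ⟨s, -, rfl⟩; exact S.Htilde_nonneg k s)

theorem Hmom_zero (k : ℝ) : Hmom S.f S.ξ S.η k 0 = Htilde S.f S.ξ S.η k 0 := by
  simp [Hmom]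

theorem exists_deriv_Htilde_le {k : ℝ} (hk : 0 ≤ k) : ∃ I I' : ℝ → ℝ, ∀ t ∈ Icc (0 : ℝ) T,
    I t = Htilde S.f S.ξ S.η k t ∧ HasDerivAt I (I' t) t ∧
    I' t ≤ momentConst k (mass S.f 0) (supf0 S.f) *
        ((eLpNorm (Efield S.f t) (ENNReal.ofReal (k + 3)) volume).toReal
          + ‖Efield S.f t (S.ξ t)‖) * Htilde S.f S.ξ S.η k t ^ ((k + 2) / (k + 3)) := by
  obtain ⟨I, hI⟩ := S.exists_hasDerivAt_Htilde k
  exact ⟨I, _, fun t ht => ⟨(hI t ht).1, (hI t ht).2.2, S.deriv_integral_le hk ht (hI t ht).2.1⟩⟩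

theorem Htilde_le_Hmom {k : ℝ} (hk : 0 ≤ k) {s t : ℝ} (ht : t ∈ Icc 0 T) (hs : s ∈ Icc 0 t) :
    Htilde S.f S.ξ S.η k s ≤ Hmom S.f S.ξ S.η k t := by
  obtain ⟨I, I', hI⟩ := S.exists_deriv_Htilde_le hk
  have hsub : Icc 0 t ⊆ Icc 0 T := Icc_subset_Icc_right ht.2
  have hc : ContinuousOn (Htilde S.f S.ξ S.η k) (Icc 0 t) :=
    ContinuousOn.congr (fun r hr => (hI r (hsub hr)).2.1.continuousAt.continuousWithinAt)
      fun r hr => (hI r (hsub hr)).1.symm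
  exact le_csSup (isCompact_Icc.image_of_continuousOn hc).bddAbove (mem_image_of_mem _ hs)

theorem deriv_Htilde_le {k : ℝ} (hk : 0 ≤ k) {t : ℝ} (ht : t ∈ Icc 0 T) :
    deriv (Htilde S.f S.ξ S.η k) t ≤ momentConst k (mass S.f 0) (supf0 S.f) *
        ((eLpNorm (Efield S.f t) (ENNReal.ofReal (k + 3)) volume).toReal
          + ‖Efield S.f t (S.ξ t)‖) * Hmom S.f S.ξ S.η k t ^ ((k + 2) / (k + 3)) := by
  have hc := momentConst_nonneg k (mass S.f 0) (supf0 S.f)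
  have hH := S.Hmom_nonneg k t
  by_cases hd : DifferentiableAt ℝ (Htilde S.f S.ξ S.η k) t
  · obtain ⟨I, I', hI⟩ := S.exists_deriv_Htilde_le hk
    have h1 : HasDerivWithinAt (Htilde S.f S.ξ S.η k) (I' t) (Icc 0 T) t :=
      (hI t ht).2.1.hasDerivWithinAt.congr (fun r hr => (hI r hr).1.symm) (hI t ht).1.symm
    rw [(uniqueDiffOn_Icc S.T_pos t ht).eq_deriv _ hd.hasDerivAt.hasDerivWithinAt h1]
    refine (hI t ht).2.2.trans (mul_le_mul_of_nonneg_left ?_ (by positivity))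
    exact Real.rpow_le_rpow (S.Htilde_nonneg k t) (S.Htilde_le_Hmom hk ht ⟨ht.1, le_rfl⟩)
      (by positivity)
  · rw [deriv_zero_of_not_differentiableAt hd]
    positivity

theorem Hmom_le_add {k : ℝ} (hk : 0 ≤ k) {t : ℝ} (ht : t ∈ Icc 0 T) :
    Hmom S.f S.ξ S.η k t ≤ Hmom S.f S.ξ S.η k 0 + momentConst k (mass S.f 0) (supf0 S.f) *
        (∫ s in (0 : ℝ)..t, ((eLpNorm (Efield S.f s) (ENNReal.ofReal (k + 3)) volume).toReal
          + ‖Efield S.f s (S.ξ s)‖)) * Hmom S.f S.ξ S.η k t ^ ((k + 2) / (k + 3)) := by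
  obtain ⟨I, I', hI⟩ := S.exists_deriv_Htilde_le hk
  have hc := momentConst_nonneg k (mass S.f 0) (supf0 S.f)
  have hH := S.Hmom_nonneg k t
  set A : ℝ → ℝ := fun s => (eLpNorm (Efield S.f s) (ENNReal.ofReal (k + 3)) volume).toReal
    + ‖Efield S.f s (S.ξ s)‖ with hA
  have hA0 : ∀ s, 0 ≤ A s := fun s => by positivity
  set P := Hmom S.f S.ξ S.η k t ^ ((k + 2) / (k + 3)) with hP
  have hP0 : 0 ≤ P := Real.rpow_nonneg hH _
  have hAi : ∀ s, IntegrableOn A (Icc 0 s) := fun s =>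
    S.integrableOn_field_norms (by linarith) 0 s
  refine csSup_le (nonempty_Icc.2 ht.1 |>.image _) ?_
  rintro _ ⟨s, hs, rfl⟩
  have hsub : Icc 0 s ⊆ Icc 0 T := Icc_subset_Icc_right (hs.2.trans ht.2)
  have h1 : I s - I 0 ≤ ∫ r in (0 : ℝ)..s, momentConst k (mass S.f 0) (supf0 S.f) * A r * P := by
    refine intervalIntegral.sub_le_integral_of_hasDeriv_right_of_le hs.1
      (fun r hr => (hI r (hsub hr)).2.1.continuousAt.continuousWithinAt)
      (fun r hr => (hI r (hsub (Ioo_subset_Icc_self hr))).2.1.hasDerivWithinAt)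
      (((hAi s).const_mul _).mul_const _) (fun r hr => ?_)
    have hr' := Ioo_subset_Icc_self hr
    refine (hI r (hsub hr')).2.2.trans (mul_le_mul_of_nonneg_left ?_ (mul_nonneg hc (hA0 r)))
    exact Real.rpow_le_rpow (S.Htilde_nonneg k r)
      (S.Htilde_le_Hmom hk ht ⟨hr'.1, hr'.2.trans hs.2⟩) (by positivity)
  have h2 : ∫ r in (0 : ℝ)..s, A r ≤ ∫ r in (0 : ℝ)..t, A r :=
    intervalIntegral.integral_mono_interval le_rfl hs.1 hs.2 (Eventually.of_forall hA0)
      ((intervalIntegrable_iff_integrableOn_Icc_of_le ht.1).2 (hAi t))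
  rw [intervalIntegral.integral_mul_const, intervalIntegral.integral_const_mul] at h1
  rw [S.Hmom_zero, ← (hI s (hsub ⟨hs.1, le_rfl⟩)).1, ← (hI 0 (hsub ⟨le_rfl, hs.1⟩)).1]
  linarith [mul_le_mul_of_nonneg_right (mul_le_mul_of_nonneg_left h2 hc) hP0]

end VPClassicalSolution

theorem le_of_le_add_mul_rpow {k H a b : ℝ} (hk : 0 ≤ k) (hH : 0 ≤ H) (ha : 0 ≤ a) (hb : 0 ≤ b)
    (h : H ≤ a + b * H ^ ((k + 2) / (k + 3))) : H ≤ 2 * a + (2 * b) ^ (k + 3) := by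
  have hb' : 0 ≤ (2 * b) ^ (k + 3) := by positivity
  by_contra! hlt
  have hH0 : 0 < H := by linarith
  have h1 : H < 2 * b * H ^ ((k + 2) / (k + 3)) := by linarith
  have h2 : H ^ (1 / (k + 3)) * H ^ ((k + 2) / (k + 3)) = H := by
    rw [← Real.rpow_add hH0, ← add_div, show 1 + (k + 2) = k + 3 by ring,
      div_self (by positivity), Real.rpow_one]
  have h3 : H ^ (1 / (k + 3)) ≤ 2 * b := by
    refine le_of_mul_le_mul_right ?_ (Real.rpow_pos_of_pos hH0 ((k + 2) / (k + 3)))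
    rw [h2]
    exact h1.le
  have h4 := Real.rpow_le_rpow (Real.rpow_nonneg hH _) h3 (by positivity : 0 ≤ k + 3)
  rw [← Real.rpow_mul hH, one_div_mul_cancel (by positivity), Real.rpow_one] at h4
  linarith

/-- Differential and integral estimates on the energy moments. -/
theorem statement_10 :
    ∃ C : ℝ → ℝ → ℝ → ℝ → ℝ,
      (∀ k a b c, 0 < C k a b c) ∧
      ∀ (T : ℝ) (S : VPClassicalSolution T), ∀ k : ℝ, 0 ≤ k → ∀ t ∈ Icc (0 : ℝ) T,
        deriv (Htilde S.f S.ξ S.η k) t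
          ≤ C k (mass S.f 0) (supf0 S.f) (energy S.f S.ξ S.η 0)
            * ((eLpNorm (Efield S.f t) (ENNReal.ofReal (k + 3)) volume).toReal
                + ‖Efield S.f t (S.ξ t)‖)
            * Hmom S.f S.ξ S.η k t ^ ((k + 2) / (k + 3))
        ∧ Hmom S.f S.ξ S.η k t
          ≤ C k (mass S.f 0) (supf0 S.f) (energy S.f S.ξ S.η 0)
            * (Hmom S.f S.ξ S.η k 0
              + (∫ s in (0 : ℝ)..t,
                  ((eLpNorm (Efield S.f s) (ENNReal.ofReal (k + 3)) volume).toReal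
                    + ‖Efield S.f s (S.ξ s)‖)) ^ (k + 3)) := by
  have hm := momentConst_nonneg
  refine ⟨fun k a b _ => momentConst k a b + 2 + (2 * momentConst k a b) ^ (k + 3),
    fun k a b c => ?_, fun T S k hk t ht => ⟨?_, ?_⟩⟩
  · have h1 := hm k a b
    positivity
  · have h1 := hm k (mass S.f 0) (supf0 S.f)
    have h2 : 0 ≤ (2 * momentConst k (mass S.f 0) (supf0 S.f)) ^ (k + 3) := by positivity
    have h3 : 0 ≤ Hmom S.f S.ξ S.η k t ^ ((k + 2) / (k + 3)) :=
      Real.rpow_nonneg (S.Hmom_nonneg k t) _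
    refine (S.deriv_Htilde_le hk ht).trans ?_
    gcongr
    linarith
  · have h1 := hm k (mass S.f 0) (supf0 S.f)
    have h2 : 0 ≤ ∫ s in (0 : ℝ)..t,
        ((eLpNorm (Efield S.f s) (ENNReal.ofReal (k + 3)) volume).toReal
          + ‖Efield S.f s (S.ξ s)‖) :=
      intervalIntegral.integral_nonneg ht.1 fun s _ => by positivity
    have h3 := S.Hmom_nonneg k 0
    have h4 := le_of_le_add_mul_rpow hk (S.Hmom_nonneg k t) h3 (mul_nonneg h1 h2)
      (S.Hmom_le_add hk ht)
    rw [← mul_assoc, Real.mul_rpow (by positivity) h2] at h4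
    have h5 : 0 ≤ (2 * momentConst k (mass S.f 0) (supf0 S.f)) ^ (k + 3) := by positivity
    refine h4.trans ?_
    rw [mul_add]
    gcongr <;> linarith

end
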